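/- Let n > 10 be an integer, p > p_c and α > 0. Suppose v₀ : [0,∞) → ℝ is continuous with 0 ≤ v₀(r) ≤ L r^{−ν} for all r > 0, φ_α(r) ≤ v₀(r) for all r ≥ 0, and v₀(r) ≤ φ_α(r) + b r^{−γ} for all r > 1, with some b > 0 and γ ∈ (ν+λ₁, (n−2)/2). Then every bounded classical radial solution v of (v^p)_t = v_rr + ((n−1)/r)v_r + v^p with initial data v₀ satisfies sup_{r ≥ 0} |v(r,t) − φ_α(r)| → 0 as t → ∞, and there exists C > 0 such that v(r,t) ≤ φ_α(r) + C(r+1)^{−γ} for all r ≥ 0 and t ≥ 0. -/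

import Mathlib

noncomputable section

open Real Filter Set Asymptotics

/-- `ν = 2/(p-1)`. -/
def nuExp (p : ℝ) : ℝ := 2 / (p - 1)

/-- `L = (ν(n−2−ν))^{1/(p−1)}`. -/
def Lconst (n : ℕ) (p : ℝ) : ℝ := (nuExp p * ((n : ℝ) - 2 - nuExp p)) ^ (1 / (p - 1))

/-- The critical exponent `p_c` for `n > 10`. -/
def pc (n : ℕ) : ℝ :=
  (((n : ℝ) - 2) ^ 2 - 4 * (n : ℝ) + 8 * Real.sqrt ((n : ℝ) - 1)) /
    (((n : ℝ) - 2) * ((n : ℝ) - 10))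

/-- `λ₁ = (n−2−2ν − √((n−2−2ν)² − 8(n−2−ν)))/2`. -/
def lam1 (n : ℕ) (p : ℝ) : ℝ :=
  (((n : ℝ) - 2 - 2 * nuExp p) -
    Real.sqrt (((n : ℝ) - 2 - 2 * nuExp p) ^ 2 - 8 * ((n : ℝ) - 2 - nuExp p))) / 2

/-- `κ(γ) = γ(n−2−γ)/(pL^{p−1}) − 1`. -/
def kappaOf (n : ℕ) (p γ : ℝ) : ℝ :=
  γ * ((n : ℝ) - 2 - γ) / (p * Lconst n p ^ (p - 1)) - 1

/-- `φ` is the (radial profile of the) positive steady state `φ_α` of `Δφ + φ^p = 0`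
with `φ(0) = α`, `φ'(0) = 0`, together with its properties in the supercritical range
`n > 10`, `p > p_c`: positivity, strict monotonicity, the bound `φ(r) ≤ L r^{−ν}`, and the
asymptotic expansion `φ(r) = L r^{−ν} − a r^{−ν−λ₁} + o(r^{−ν−λ₁})` with coefficient `a > 0`. -/
structure IsSteadyStateA (n : ℕ) (p α : ℝ) (φ : ℝ → ℝ) (a : ℝ) : Prop where
  cont : ContinuousOn φ (Set.Ici 0)
  smooth : ContDiffOn ℝ 2 φ (Set.Ioi 0)
  ode : ∀ r > (0 : ℝ), deriv (deriv φ) r + ((n : ℝ) - 1) / r * deriv φ r + φ r ^ p = 0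
  val0 : φ 0 = α
  deriv0 : derivWithin φ (Set.Ici 0) 0 = 0
  pos : ∀ r ≥ (0 : ℝ), 0 < φ r
  anti : StrictAntiOn φ (Set.Ici 0)
  upper : ∀ r > (0 : ℝ), φ r ≤ Lconst n p * r ^ (-nuExp p)
  a_pos : 0 < a
  expansion :
    (fun r => φ r - (Lconst n p * r ^ (-nuExp p) - a * r ^ (-nuExp p - lam1 n p)))
      =o[atTop] fun r => r ^ (-nuExp p - lam1 n p)

/-- `v` is a bounded classical radial solution of
`(v^p)_t = v_rr + ((n−1)/r) v_r + v^p` with initial data `v₀ : [0,∞) → ℝ`: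
nonnegative and continuous on `[0,∞) × [0,∞)`, bounded on `[0,∞) × [0,T]` for every
`T > 0`, `C²` in `r` and `C¹` in `t` for `t > 0` with `∂_r v(0,t) = 0`, satisfying the
equation pointwise for `r > 0`, `t > 0`, and attaining the initial data. -/
structure IsRadialSol (n : ℕ) (p : ℝ) (v : ℝ → ℝ → ℝ) (v₀ : ℝ → ℝ) : Prop where
  nonneg : ∀ r ≥ (0 : ℝ), ∀ t ≥ (0 : ℝ), 0 ≤ v r t
  cont : ContinuousOn (fun q : ℝ × ℝ => v q.1 q.2) (Set.Ici 0 ×ˢ Set.Ici 0)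
  bdd : ∀ T > (0 : ℝ), ∃ M, ∀ r ≥ (0 : ℝ), ∀ t ∈ Set.Icc (0 : ℝ) T, v r t ≤ M
  smooth_r : ∀ t > (0 : ℝ), ContDiffOn ℝ 2 (fun r => v r t) (Set.Ici 0)
  smooth_t : ∀ r ≥ (0 : ℝ), ContDiffOn ℝ 1 (fun s => v r s ^ p) (Set.Ioi (0 : ℝ))
  slope0 : ∀ t > (0 : ℝ), derivWithin (fun r => v r t) (Set.Ici 0) 0 = 0
  pde : ∀ r > (0 : ℝ), ∀ t > (0 : ℝ),
    deriv (fun s => v r s ^ p) t =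
      deriv (deriv fun ρ => v ρ t) r + ((n : ℝ) - 1) / r * deriv (fun ρ => v ρ t) r
        + v r t ^ p
  init : ∀ r ≥ (0 : ℝ), v r 0 = v₀ r


/-- Second order jet. -/
def D2 (f : ℝ → ℝ) (r d1 d2 : ℝ) : Prop :=
  ∃ g : ℝ → ℝ, (∀ᶠ ρ in nhds r, HasDerivAt f (g ρ) ρ) ∧ g r = d1 ∧ HasDerivAt g d2 r

lemma D2.deriv_eq {f : ℝ → ℝ} {r d1 d2 : ℝ} (h : D2 f r d1 d2) : deriv f r = d1 := by
  obtain ⟨g, h1, h2, h3⟩ := h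
  rw [← h2]; exact h1.self_of_nhds.deriv

lemma D2.deriv2_eq {f : ℝ → ℝ} {r d1 d2 : ℝ} (h : D2 f r d1 d2) : deriv (deriv f) r = d2 := by
  obtain ⟨g, h1, h2, h3⟩ := h
  have : deriv f =ᶠ[nhds r] g := h1.mono fun ρ h => h.deriv
  rw [this.deriv_eq]; exact h3.deriv

lemma D2.hasDerivAt {f : ℝ → ℝ} {r d1 d2 : ℝ} (h : D2 f r d1 d2) : HasDerivAt f d1 r := by
  obtain ⟨g, h1, h2, h3⟩ := h
  rw [← h2]; exact h1.self_of_nhds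

lemma D2.add {f g : ℝ → ℝ} {r a b c d : ℝ} (h : D2 f r a b) (k : D2 g r c d) :
    D2 (fun x => f x + g x) r (a + c) (b + d) := by
  obtain ⟨f', h1, h2, h3⟩ := h
  obtain ⟨g', k1, k2, k3⟩ := k
  refine ⟨fun x => f' x + g' x, ?_, by simp [h2, k2], h3.add k3⟩
  filter_upwards [h1, k1] with x hx kx using hx.add kx

lemma D2.sub {f g : ℝ → ℝ} {r a b c d : ℝ} (h : D2 f r a b) (k : D2 g r c d) :
    D2 (fun x => f x - g x) r (a - c) (b - d) := by
  obtain ⟨f', h1, h2, h3⟩ := h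
  obtain ⟨g', k1, k2, k3⟩ := k
  refine ⟨fun x => f' x - g' x, ?_, by simp [h2, k2], h3.sub k3⟩
  filter_upwards [h1, k1] with x hx kx using hx.sub kx

lemma D2.const (c r : ℝ) : D2 (fun _ => c) r 0 0 :=
  ⟨fun _ => 0, Eventually.of_forall fun x => hasDerivAt_const x c, rfl, hasDerivAt_const r 0⟩

lemma D2.mul {f g : ℝ → ℝ} {r a b c d : ℝ} (h : D2 f r a b) (k : D2 g r c d) :
    D2 (fun x => f x * g x) r (a * g r + f r * c) (b * g r + 2 * a * c + f r * d) := by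
  have hf := h.hasDerivAt
  have hg := k.hasDerivAt
  obtain ⟨f', h1, h2, h3⟩ := h
  obtain ⟨g', k1, k2, k3⟩ := k
  refine ⟨fun x => f' x * g x + f x * g' x, ?_, by simp [h2, k2], ?_⟩
  · filter_upwards [h1, k1] with x hx kx using hx.mul kx
  · have := (h3.mul hg).add (hf.mul k3)
    refine this.congr_deriv ?_
    rw [h2, k2]; ring

lemma D2.const_mul {f : ℝ → ℝ} {r a b : ℝ} (c : ℝ) (h : D2 f r a b) :
    D2 (fun x => c * f x) r (c * a) (c * b) := by
  obtain ⟨f', h1, h2, h3⟩ := h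
  refine ⟨fun x => c * f' x, ?_, by simp [h2], h3.const_mul c⟩
  filter_upwards [h1] with x hx using hx.const_mul c

lemma D2.comp {g f : ℝ → ℝ} {r a b c d : ℝ} (h : D2 g (f r) a b) (k : D2 f r c d) :
    D2 (fun x => g (f x)) r (a * c) (b * c ^ 2 + a * d) := by
  have hf := k.hasDerivAt
  obtain ⟨g', h1, h2, h3⟩ := h
  obtain ⟨f', k1, k2, k3⟩ := k
  refine ⟨fun x => g' (f x) * f' x, ?_, by simp [h2, k2], ?_⟩
  · have := hf.continuousAt.eventually h1
    filter_upwards [this, k1] with x hx kx using hx.comp x kx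
  · have := (h3.comp r hf).mul k3
    refine this.congr_deriv ?_
    simp only [Function.comp]
    rw [h2, k2]; ring

lemma D2.rpow {r : ℝ} (hr : 0 < r) (c : ℝ) :
    D2 (fun x => x ^ c) r (c * r ^ c / r) (c * (c - 1) * r ^ c / r ^ 2) := by
  refine ⟨fun x => c * x ^ (c - 1), ?_, ?_, ?_⟩
  · filter_upwards [lt_mem_nhds hr] with x hx
    exact Real.hasDerivAt_rpow_const (Or.inl hx.ne')
  · simp only [Real.rpow_sub_one hr.ne']; ring
  · have := (Real.hasDerivAt_rpow_const (p := c - 1) (Or.inl hr.ne')).const_mul c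
    refine this.congr_deriv ?_
    rw [Real.rpow_sub_one hr.ne', Real.rpow_sub_one hr.ne']; field_simp

lemma D2.of_contDiffOn {f : ℝ → ℝ} {s : Set ℝ} (h : ContDiffOn ℝ 2 f s) {r : ℝ} (hs : s ∈ nhds r) :
    D2 f r (deriv f r) (deriv (deriv f) r) := by
  have h2 : ContDiffAt ℝ 2 f r := h.contDiffAt hs
  refine ⟨deriv f, ?_, rfl, ?_⟩
  · have : ∀ᶠ x in nhds r, ContDiffAt ℝ 2 f x := h2.eventually (by simp)
    filter_upwards [this] with x hx
    exact (hx.differentiableAt (by norm_num)).hasDerivAt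
  · have : ContDiffOn ℝ 1 (deriv f) (interior s) :=
      (h.mono interior_subset).deriv_of_isOpen isOpen_interior (by norm_num)
    exact ((this.contDiffAt (interior_mem_nhds.2 hs)).differentiableAt (by norm_num)).hasDerivAt

/-- second derivative test -/
lemma D2.max_test {f : ℝ → ℝ} {r d1 d2 : ℝ} (h : D2 f r d1 d2) (hm : IsLocalMax f r) :
    d1 = 0 ∧ d2 ≤ 0 := by
  have e1 := h.deriv_eq
  have e2 := h.deriv2_eq
  have hz := hm.deriv_eq_zero
  refine ⟨by rw [← e1, hz], ?_⟩
  by_contra hlt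
  push Not at hlt
  have hmin : IsLocalMin f r :=
    isLocalMin_of_deriv_deriv_pos (by rw [e2]; exact hlt) hz h.hasDerivAt.continuousAt
  have hc : f =ᶠ[nhds r] fun _ => f r := by
    filter_upwards [hm, hmin] with x hx hx' using le_antisymm hx hx'
  have : deriv (deriv f) r = 0 := by
    have h1 : deriv f =ᶠ[nhds r] deriv (fun _ => f r) := hc.deriv
    rw [h1.deriv_eq]; simp
  linarith

/-- one-sided derivative test -/
lemma left_test {g : ℝ → ℝ} {t d : ℝ} (h : HasDerivAt g d t) (hle : ∀ᶠ s in nhdsWithin t (Iio t), g s ≤ g t) :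
    0 ≤ d := by
  have h1 := (hasDerivWithinAt_iff_tendsto_slope' (by simp)).1 (h.hasDerivWithinAt (s := Iio t))
  refine ge_of_tendsto h1 ?_
  filter_upwards [hle, self_mem_nhdsWithin] with s hs hs'
  rw [slope_def_field]
  have : s < t := hs'
  exact div_nonneg_of_nonpos (by linarith) (by linarith)

lemma first_touch {f : ℝ → ℝ → ℝ} {r1 r2 T0 T1 : ℝ}
    (hc : ContinuousOn (fun q : ℝ × ℝ => f q.1 q.2) (Icc r1 r2 ×ˢ Icc T0 T1))
    (h0 : ∀ r ∈ Icc r1 r2, f r T0 < 0)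
    (hb1 : ∀ t ∈ Icc T0 T1, f r1 t < 0) (hb2 : ∀ t ∈ Icc T0 T1, f r2 t < 0)
    (hstep : ∀ r ∈ Ioo r1 r2, ∀ t ∈ Ioc T0 T1, f r t = 0 → (∀ᶠ ρ in nhds r, f ρ t ≤ 0) →
      (∀ᶠ s in nhdsWithin t (Iio t), f r s ≤ 0) → False) :
    ∀ r ∈ Icc r1 r2, ∀ t ∈ Icc T0 T1, f r t < 0 := by
  by_contra hcon
  push Not at hcon
  obtain ⟨ra, hra, ta, hta, hfa⟩ := hcon
  have hK : IsCompact (Icc r1 r2 ×ˢ Icc T0 T1) := isCompact_Icc.prod isCompact_Icc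
  set A := (Icc r1 r2 ×ˢ Icc T0 T1) ∩ (fun q : ℝ × ℝ => f q.1 q.2) ⁻¹' Ici 0 with hA
  have hAcl : IsClosed A := hc.preimage_isClosed_of_isClosed hK.isClosed isClosed_Ici
  have hAc : IsCompact A := hK.of_isClosed_subset hAcl inter_subset_left
  have hne : A.Nonempty := ⟨(ra, ta), ⟨hra, hta⟩, hfa⟩
  obtain ⟨⟨r, t⟩, ⟨⟨hr, ht⟩, hf⟩, hmin⟩ := hAc.exists_isMinOn hne continuousOn_snd
  simp only at hr ht
  have hf : 0 ≤ f r t := hf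
  have hlt : ∀ r' ∈ Icc r1 r2, ∀ s ∈ Icc T0 T1, s < t → f r' s < 0 := by
    intro r' hr' s hs hst
    by_contra hge
    push Not at hge
    have := hmin (a := (r', s)) ⟨⟨hr', hs⟩, hge⟩
    simp only [mem_ofPred_eq] at this
    linarith
  have htT : T0 < t := by
    rcases ht.1.lt_or_eq with h | h
    · exact h
    · have := h0 r hr; rw [h] at this; linarith
  have hle : ∀ r' ∈ Icc r1 r2, f r' t ≤ 0 := by
    intro r' hr'
    have hcr : ContinuousWithinAt (fun s => f r' s) (Icc T0 T1) t := by
      have := hc (r', t) ⟨hr', ht⟩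
      exact this.comp (f := fun s : ℝ => (r', s)) (by fun_prop) (fun s hs => ⟨hr', hs⟩)
    have hcr2 : Tendsto (fun s => f r' s) (nhdsWithin t (Ioo T0 t)) (nhds (f r' t)) :=
      hcr.mono (fun s hs => ⟨hs.1.le, hs.2.le.trans ht.2⟩)
    have : (nhdsWithin t (Ioo T0 t)).NeBot := by
      rw [nhdsWithin_Ioo_eq_nhdsLT htT]; infer_instance
    refine le_of_tendsto hcr2 ?_
    filter_upwards [self_mem_nhdsWithin] with s hs
    exact (hlt r' hr' s ⟨hs.1.le, hs.2.le.trans ht.2⟩ hs.2).le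
  have hr1 : r1 < r := by
    rcases hr.1.lt_or_eq with h | h
    · exact h
    · have := hb1 t ht; rw [h] at this; linarith
  have hr2 : r < r2 := by
    rcases hr.2.lt_or_eq with h | h
    · exact h
    · have := hb2 t ht; rw [← h] at this; linarith
  refine hstep r ⟨hr1, hr2⟩ t ⟨htT, ht.2⟩ (le_antisymm (hle r hr) hf) ?_ ?_
  · filter_upwards [Icc_mem_nhds hr1 hr2] with ρ hρ using hle ρ hρ
  · filter_upwards [Ioo_mem_nhdsLT htT] with s hs
    exact (hlt r hr s ⟨hs.1.le, hs.2.le.trans ht.2⟩ hs.2).le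

lemma v_D2 {n : ℕ} {p : ℝ} {v : ℝ → ℝ → ℝ} {v₀ : ℝ → ℝ} (hv : IsRadialSol n p v v₀) {r t : ℝ}
    (hr : 0 < r) (ht : 0 < t) :
    D2 (fun ρ => v ρ t) r (deriv (fun ρ => v ρ t) r) (deriv (deriv fun ρ => v ρ t) r) :=
  D2.of_contDiffOn (hv.smooth_r t ht) (Ici_mem_nhds hr)

lemma v_dt {n : ℕ} {p : ℝ} {v : ℝ → ℝ → ℝ} {v₀ : ℝ → ℝ} (hv : IsRadialSol n p v v₀) {r t : ℝ}
    (hr : 0 < r) (ht : 0 < t) :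
    HasDerivAt (fun s => v r s ^ p) (deriv (fun s => v r s ^ p) t) t :=
  (((hv.smooth_t r hr.le).contDiffAt (Ioi_mem_nhds ht)).differentiableAt (by norm_num)).hasDerivAt

lemma touch_upper {n : ℕ} {p : ℝ} {v : ℝ → ℝ → ℝ} {v₀ : ℝ → ℝ} (hv : IsRadialSol n p v v₀)
    (hp : 1 < p) {r t : ℝ} (hr : 0 < r) (ht : 0 < t) {Ψ : ℝ → ℝ → ℝ} {d1 d2 dt : ℝ}
    (hD : D2 (fun ρ => Ψ ρ t) r d1 d2) (hT : HasDerivAt (fun s => Ψ r s) dt t)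
    (heq : v r t = Ψ r t) (hsp : ∀ᶠ ρ in nhds r, v ρ t ≤ Ψ ρ t)
    (htm : ∀ᶠ s in nhdsWithin t (Iio t), v r s ≤ Ψ r s) :
    p * (Ψ r t) ^ (p - 1) * dt ≤ d2 + ((n : ℝ) - 1) / r * d1 + (Ψ r t) ^ p := by
  have hx := ((v_D2 hv hr ht).sub hD).max_test (by
    filter_upwards [hsp] with ρ hρ
    simp only [heq]; linarith)
  have hT' := hT.rpow_const (p := p) (Or.inr hp.le)
  have hy := left_test ((v_dt hv hr ht).sub hT') (by
    have : ∀ᶠ s in nhdsWithin t (Iio t), 0 < s := nhdsWithin_le_nhds (lt_mem_nhds ht)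
    filter_upwards [htm, this] with s hs hs0
    have := Real.rpow_le_rpow (hv.nonneg r hr.le s hs0.le) hs (by linarith : (0:ℝ) ≤ p)
    simp only [Pi.sub_apply, heq]; linarith)
  have hpde := hv.pde r hr t ht
  rw [hpde] at hy
  have e1 : deriv (fun ρ => v ρ t) r = d1 := by linarith [hx.1]
  rw [e1, heq] at hy
  nlinarith [hx.2]

lemma touch_lower {n : ℕ} {p : ℝ} {v : ℝ → ℝ → ℝ} {v₀ : ℝ → ℝ} (hv : IsRadialSol n p v v₀)
    (hp : 1 < p) {r t : ℝ} (hr : 0 < r) (ht : 0 < t) {Ψ : ℝ → ℝ → ℝ} {d1 d2 dt : ℝ}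
    (hD : D2 (fun ρ => Ψ ρ t) r d1 d2) (hT : HasDerivAt (fun s => Ψ r s) dt t)
    (heq : v r t = Ψ r t) (hsp : ∀ᶠ ρ in nhds r, Ψ ρ t ≤ v ρ t)
    (htm : ∀ᶠ s in nhdsWithin t (Iio t), Ψ r s ≤ v r s)
    (hmono : ∀ s < t, Ψ r t ≤ Ψ r s) :
    d2 + ((n : ℝ) - 1) / r * d1 + (Ψ r t) ^ p ≤ p * (Ψ r t) ^ (p - 1) * dt := by
  have hx := (hD.sub (v_D2 hv hr ht)).max_test (by
    filter_upwards [hsp] with ρ hρ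
    simp only [heq]; linarith)
  have hT' := hT.rpow_const (p := p) (Or.inr hp.le)
  have h0 : 0 ≤ Ψ r t := heq ▸ hv.nonneg r hr.le t ht.le
  have hy := left_test (hT'.sub (v_dt hv hr ht)) (by
    filter_upwards [htm, self_mem_nhdsWithin] with s hs hs0
    have := Real.rpow_le_rpow (h0.trans (hmono s hs0)) hs (by linarith : (0:ℝ) ≤ p)
    simp only [Pi.sub_apply, heq]; linarith)
  have hpde := hv.pde r hr t ht
  rw [hpde] at hy
  have e1 : deriv (fun ρ => v ρ t) r = d1 := by linarith [hx.1]
  rw [e1, heq] at hy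
  nlinarith [hx.2]

lemma pow_conv {p x y : ℝ} (hp : 1 < p) (hx : 0 ≤ x) (hy : 0 < y) :
    y ^ p - x ^ p ≤ p * y ^ (p - 1) * (y - x) := by
  have h := one_add_mul_self_le_rpow_one_add (s := x / y - 1) (by
    have : 0 ≤ x / y := by positivity
    linarith) hp.le
  have e : 1 + (x / y - 1) = x / y := by ring
  rw [e, Real.div_rpow hx hy.le] at h
  have hyp : 0 < y ^ p := Real.rpow_pos_of_pos hy p
  rw [le_div_iff₀ hyp] at h
  rw [Real.rpow_sub_one hy.ne']
  have : p * (y ^ p / y) * (y - x) = y ^ p * p * (1 - x / y) := by field_simp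
  rw [this]; linarith

/-- The singular steady state. -/
def Sst (n : ℕ) (p r : ℝ) : ℝ := Lconst n p * r ^ (-nuExp p)

lemma par_p {n : ℕ} (hn : 10 < n) {p : ℝ} (hp : pc n < p) :
    1 < p ∧ 0 < nuExp p ∧ 2 * nuExp p < (n : ℝ) - 2 := by
  have hN : (10 : ℝ) < n := by exact_mod_cast hn
  have hden : 0 < ((n : ℝ) - 2) * ((n : ℝ) - 10) := mul_pos (by linarith) (by linarith)
  unfold pc at hp
  rw [div_lt_iff₀ hden] at hp
  have hs := Real.sqrt_nonneg ((n : ℝ) - 1)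
  have h1 : (n : ℝ) + 2 < p * ((n : ℝ) - 2) := by
    by_contra hc
    push Not at hc
    have := mul_le_mul_of_nonneg_right hc (by linarith : (0:ℝ) ≤ (n:ℝ) - 10)
    nlinarith
  have hp1 : 1 < p := by
    by_contra hc
    push Not at hc
    have := mul_le_mul_of_nonneg_right hc (by linarith : (0:ℝ) ≤ (n:ℝ) - 2)
    linarith
  refine ⟨hp1, ?_, ?_⟩
  · unfold nuExp; exact div_pos two_pos (by linarith)
  · unfold nuExp
    have : 0 < p - 1 := by linarith
    rw [← mul_div_assoc, div_lt_iff₀ this]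
    nlinarith

lemma par_nu {p : ℝ} (hp : 1 < p) : nuExp p * (p - 1) = 2 := by
  unfold nuExp
  have : p - 1 ≠ 0 := by linarith
  field_simp

lemma par_L {n : ℕ} {p : ℝ} (hp : 1 < p) (hν : 0 < nuExp p) (h2 : 2 * nuExp p < (n : ℝ) - 2) :
    0 < Lconst n p ∧ Lconst n p ^ (p - 1) = nuExp p * ((n : ℝ) - 2 - nuExp p) := by
  have : 0 < nuExp p * ((n : ℝ) - 2 - nuExp p) := mul_pos hν (by linarith)
  unfold Lconst
  refine ⟨Real.rpow_pos_of_pos this _, ?_⟩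
  rw [← Real.rpow_mul this.le, one_div_mul_cancel (by linarith), Real.rpow_one]

lemma par_lam {n : ℕ} {p γ : ℝ} (hν : 0 < nuExp p) (h2 : 2 * nuExp p < (n : ℝ) - 2)
    (hγ : γ ∈ Set.Ioo (nuExp p + lam1 n p) (((n : ℝ) - 2) / 2)) :
    0 < lam1 n p ∧ (nuExp p + 2) * ((n : ℝ) - 2 - nuExp p) < γ * ((n : ℝ) - 2 - γ) := by
  obtain ⟨ha, hb⟩ := hγ
  unfold lam1 at *
  set ν := nuExp p
  set N : ℝ := (n : ℝ)
  set D := (N - 2 - 2 * ν) ^ 2 - 8 * (N - 2 - ν) with hD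
  have hs : 0 < Real.sqrt D := by linarith
  have hDpos : 0 < D := Real.sqrt_pos.1 hs
  have hsq := Real.sq_sqrt hDpos.le
  constructor
  · have : Real.sqrt D < N - 2 - 2 * ν := by
      apply lt_of_pow_lt_pow_left₀ 2 (by linarith)
      rw [hsq]; linarith
    linarith
  · -- (2γ - (N-2))^2 < D
    have h1 : 0 < (N - 2) - 2 * γ := by linarith
    have h3 : (N - 2) - 2 * γ < Real.sqrt D := by linarith
    have : ((N - 2) - 2 * γ) ^ 2 < (Real.sqrt D) ^ 2 := by
      apply pow_lt_pow_left₀ h3 h1.le (by norm_num)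
    rw [hsq] at this
    nlinarith

lemma S_pow {n : ℕ} {p r : ℝ} (hp : 1 < p) (hL : 0 < Lconst n p) (hr : 0 < r) :
    Sst n p r ^ (p - 1) = Lconst n p ^ (p - 1) / r ^ 2 := by
  unfold Sst
  rw [Real.mul_rpow hL.le (Real.rpow_nonneg hr.le _), ← Real.rpow_mul hr.le]
  have : -nuExp p * (p - 1) = -(2 : ℝ) := by rw [neg_mul, par_nu hp]
  rw [this, Real.rpow_neg hr.le]
  norm_num [div_eq_mul_inv]

lemma S_pos {n : ℕ} {p r : ℝ} (hL : 0 < Lconst n p) (hr : 0 < r) : 0 < Sst n p r :=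
  mul_pos hL (Real.rpow_pos_of_pos hr _)

lemma S_D2 {n : ℕ} {p r : ℝ} (hp : 1 < p) (hL : 0 < Lconst n p)
    (hL2 : Lconst n p ^ (p - 1) = nuExp p * ((n : ℝ) - 2 - nuExp p)) (hr : 0 < r) :
    ∃ d1 d2, D2 (Sst n p) r d1 d2 ∧ d2 + ((n : ℝ) - 1) / r * d1 + Sst n p r ^ p = 0 := by
  refine ⟨_, _, (D2.rpow hr (-nuExp p)).const_mul (Lconst n p), ?_⟩
  have h1 : Sst n p r ^ p = Sst n p r ^ (p - 1) * Sst n p r := by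
    rw [Real.rpow_sub_one (S_pos hL hr).ne']; field_simp [(S_pos hL hr).ne']
  rw [h1, S_pow hp hL hr, hL2]
  unfold Sst
  field_simp
  ring

lemma lap_pow {n : ℕ} {r c : ℝ} (hr : 0 < r) :
    c * (c - 1) * r ^ c / r ^ 2 + ((n : ℝ) - 1) / r * (c * r ^ c / r)
      = c * ((n : ℝ) - 2 + c) * r ^ c / r ^ 2 := by
  field_simp
  ring

lemma upper_comp {n : ℕ} {p : ℝ} {v : ℝ → ℝ → ℝ} {v₀ : ℝ → ℝ} (hv : IsRadialSol n p v v₀)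
    (hp : 1 < p) {ϕ : ℝ → ℝ}
    (hϕD : ∀ r > (0:ℝ), ∃ d1 d2, D2 ϕ r d1 d2 ∧ d2 + ((n : ℝ) - 1) / r * d1 + ϕ r ^ p = 0)
    (hϕpos : ∀ r > (0:ℝ), 0 < ϕ r) {c : ℝ} (hc : 0 < c)
    (hϕc : ∀ r > (0:ℝ), c ≤ ϕ r ^ (p - 1) * (1 + r ^ 2))
    {W : ℝ → ℝ → ℝ} {t0 : ℝ} (ht0 : 0 ≤ t0)
    (hWnn : ∀ r > (0:ℝ), ∀ t ≥ t0, 0 ≤ W r t)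
    (hWc : ContinuousOn (fun q : ℝ × ℝ => W q.1 q.2) (Ioi 0 ×ˢ Ici t0))
    (hW : ∀ r > (0:ℝ), ∀ t > t0, ∃ d1 d2 dt, D2 (fun ρ => W ρ t) r d1 d2 ∧
      HasDerivAt (fun s => W r s) dt t ∧
      (ϕ r + W r t ≤ v r t → d2 + ((n : ℝ) - 1) / r * d1 + p * v r t ^ (p - 1) * W r t
        ≤ p * v r t ^ (p - 1) * dt))
    (h0 : ∀ T > t0, ∃ r1 > (0:ℝ), ∀ r ∈ Ioc 0 r1, ∀ t ∈ Icc t0 T, v r t ≤ ϕ r + W r t)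
    (hin : ∀ r > (0:ℝ), v r t0 ≤ ϕ r + W r t0) :
    ∀ r > (0:ℝ), ∀ t ≥ t0, v r t ≤ ϕ r + W r t := by
  intro ra hra ta hta
  set T := ta + 1
  obtain ⟨K, hK⟩ : ∃ K : ℝ, 2 * (n : ℝ) < p * c * (K - 1) := by
    have : 0 < p * c := mul_pos (by linarith) hc
    refine ⟨1 + (2 * n + 1) / (p * c), ?_⟩
    field_simp
    linarith
  have key : ∀ ε > (0:ℝ), v ra ta ≤ ϕ ra + W ra ta + ε * (Real.exp (K * (ta - t0)) * (1 + ra ^ 2)) := by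
    intro ε hε
    obtain ⟨r1, hr1, hr1v⟩ := h0 T (by simp only [T]; linarith)
    obtain ⟨M, hM⟩ := hv.bdd T (by simp only [T]; linarith)
    have hK0 : 0 ≤ K := by
      by_contra hk
      push Not at hk
      have : 0 < p * c := mul_pos (by linarith) hc
      have : p * c * (K - 1) < 0 := mul_neg_of_pos_of_neg this (by linarith)
      have : (0:ℝ) ≤ n := Nat.cast_nonneg n
      linarith
    have hexp : ∀ t ≥ t0, 1 ≤ Real.exp (K * (t - t0)) := fun t ht =>
      Real.one_le_exp (mul_nonneg hK0 (by linarith))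
    set r2 := max ra (1 + |M| / ε) with hr2
    have hr2M : M < ε * (1 + r2 ^ 2) := by
      have h1 : 1 + |M| / ε ≤ r2 := le_max_right _ _
      have h2 : 0 ≤ |M| / ε := by positivity
      have h3 : |M| / ε ≤ r2 ^ 2 := by nlinarith
      rw [div_le_iff₀ hε] at h3
      nlinarith [le_abs_self M]
    have hft := first_touch (f := fun r t => v r t - (ϕ r + W r t +
      ε * (Real.exp (K * (t - t0)) * (1 + r ^ 2)))) (r1 := min ra r1) (r2 := r2) (T0 := t0) (T1 := T)
      ?_ ?_ ?_ ?_ ?_ ra ⟨min_le_left _ _, le_max_left _ _⟩ ta ⟨hta, by simp [T]⟩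
    · linarith
    · have hr0 : 0 < min ra r1 := lt_min hra hr1
      have s1 : Icc (min ra r1) r2 ×ˢ Icc t0 T ⊆ Ioi (0:ℝ) ×ˢ Ici t0 := by
        rintro ⟨x, y⟩ ⟨hx, hy⟩
        exact ⟨lt_of_lt_of_le hr0 hx.1, hy.1⟩
      have s2 : Icc (min ra r1) r2 ×ˢ Icc t0 T ⊆ Ici (0:ℝ) ×ˢ Ici (0:ℝ) := by
        rintro ⟨x, y⟩ ⟨hx, hy⟩
        exact ⟨hr0.le.trans hx.1, ht0.trans hy.1⟩
      have c1 := hv.cont.mono s2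
      have c2 := hWc.mono s1
      have c3 : ContinuousOn (fun q : ℝ × ℝ => ϕ q.1) (Icc (min ra r1) r2 ×ˢ Icc t0 T) := by
        have : ContinuousOn ϕ (Ioi 0) := fun x hx => by
          obtain ⟨d1, d2, h, -⟩ := hϕD x hx
          exact h.hasDerivAt.continuousAt.continuousWithinAt
        exact this.comp continuousOn_fst (fun q hq => (s1 hq).1)
      have c4 : ContinuousOn (fun q : ℝ × ℝ => ε * (Real.exp (K * (q.2 - t0)) * (1 + q.1 ^ 2)))
        (Icc (min ra r1) r2 ×ˢ Icc t0 T) := by fun_prop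
      exact c1.sub ((c3.add c2).add c4)
    · intro r hr
      have hr0 : 0 < r := lt_of_lt_of_le (lt_min hra hr1) hr.1
      have := hin r hr0
      have : 0 < ε * (Real.exp (K * (t0 - t0)) * (1 + r ^ 2)) := by positivity
      linarith
    · intro t ht
      have hr0 : 0 < min ra r1 := lt_min hra hr1
      have := hr1v (min ra r1) ⟨hr0, min_le_right _ _⟩ t ht
      have : 0 < ε * (Real.exp (K * (t - t0)) * (1 + (min ra r1) ^ 2)) := by positivity
      linarith
    · intro t ht
      have hr20 : 0 < r2 := lt_of_lt_of_le hra (le_max_left _ _)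
      have h1 := hM r2 hr20.le t ⟨ht0.trans ht.1, ht.2⟩
      have h2 := hϕpos r2 hr20
      have h3 := hWnn r2 hr20 t ht.1
      have h4 : ε * (1 + r2 ^ 2) ≤ ε * (Real.exp (K * (t - t0)) * (1 + r2 ^ 2)) := by
        apply mul_le_mul_of_nonneg_left _ hε.le
        have : 0 ≤ 1 + r2 ^ 2 := by positivity
        nlinarith [hexp t ht.1]
      linarith
    · intro r hr t ht heq hsp htm
      have hr0 : 0 < r := lt_of_lt_of_le (lt_min hra hr1) hr.1.le
      have ht00 : 0 < t := lt_of_le_of_lt ht0 ht.1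
      obtain ⟨a1, a2, hDa, hode⟩ := hϕD r hr0
      obtain ⟨b1, b2, bt, hDb, hTb, hineq⟩ := hW r hr0 t ht.1
      set e := Real.exp (K * (t - t0)) with he
      have he0 : 0 < e := Real.exp_pos _
      have hDq : D2 (fun x : ℝ => ε * (e * (1 + x ^ 2))) r (ε * (e * (2 * r))) (ε * (e * 2)) := by
        refine ⟨fun x => ε * (e * (2 * x)), Eventually.of_forall fun x => ?_, rfl, ?_⟩
        · have := (((hasDerivAt_id x).pow 2).const_add 1).const_mul e |>.const_mul ε
          refine this.congr_deriv ?_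
          simp
        · have := (((hasDerivAt_id r).const_mul 2).const_mul e).const_mul ε
          refine this.congr_deriv ?_
          simp
      have hTq : HasDerivAt (fun s => ε * (Real.exp (K * (s - t0)) * (1 + r ^ 2)))
          (K * (ε * (e * (1 + r ^ 2)))) t := by
        have := ((((hasDerivAt_id t).sub_const t0).const_mul K).exp.mul_const (1 + r ^ 2)).const_mul ε
        refine this.congr_deriv ?_
        simp only [he, id]; ring
      have hT1 : HasDerivAt (fun s => ϕ r + W r s + ε * (Real.exp (K * (s - t0)) * (1 + r ^ 2)))
          (bt + K * (ε * (e * (1 + r ^ 2)))) t := (hTb.const_add (ϕ r)).add hTq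
      have htu := touch_upper hv hp hr0 ht00
        (Ψ := fun r t => ϕ r + W r t + ε * (Real.exp (K * (t - t0)) * (1 + r ^ 2)))
        ((hDa.add hDb).add hDq) hT1 (by linarith) (hsp.mono fun x hx => by linarith)
        (htm.mono fun x hx => by linarith)
      have hval : v r t = ϕ r + W r t + ε * (e * (1 + r ^ 2)) := by linarith
      simp only [← he] at htu
      rw [← hval] at htu
      set E := ε * (e * (1 + r ^ 2)) with hE
      have hE0 : 0 < E := by positivity
      have hϕr := hϕpos r hr0
      have hWr := hWnn r hr0 t ht.1.le
      have hy0 : 0 < v r t := by linarith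
      have hineq := hineq (by linarith)
      have hconv := pow_conv hp hϕr.le hy0
      have hmono : ϕ r ^ (p - 1) ≤ v r t ^ (p - 1) :=
        Real.rpow_le_rpow hϕr.le (by linarith) (by linarith)
      set Y := v r t ^ (p - 1)
      have hc1 : c ≤ Y * (1 + r ^ 2) :=
        (hϕc r hr0).trans (mul_le_mul_of_nonneg_right hmono (by positivity))
      have hlap : ε * (e * 2) + ((n : ℝ) - 1) / r * (ε * (e * (2 * r))) = 2 * n * (ε * e) := by
        field_simp; ring
      have e1 : v r t - ϕ r = W r t + E := by linarith
      rw [e1] at hconv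
      have hfin : p * Y * (K - 1) * E ≤ 2 * n * (ε * e) := by nlinarith
      have e2 : p * Y * (K - 1) * E = (p * (Y * (1 + r ^ 2)) * (K - 1)) * (ε * e) := by
        rw [hE]; ring
      rw [e2] at hfin
      have hfin2 := le_of_mul_le_mul_right hfin (by positivity)
      have hK1 : 0 < K - 1 := by
        by_contra hk
        push Not at hk
        have : 0 < p * c := mul_pos (by linarith) hc
        have : p * c * (K - 1) ≤ 0 := mul_nonpos_of_nonneg_of_nonpos this.le hk
        have : (0:ℝ) ≤ n := Nat.cast_nonneg n
        linarith
      have : p * c * (K - 1) ≤ p * (Y * (1 + r ^ 2)) * (K - 1) :=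
        mul_le_mul_of_nonneg_right (mul_le_mul_of_nonneg_left hc1 (by linarith)) hK1.le
      linarith
  have hQ : 0 < Real.exp (K * (ta - t0)) * (1 + ra ^ 2) := by positivity
  refine le_of_forall_pos_le_add fun η hη => ?_
  have := key (η / (Real.exp (K * (ta - t0)) * (1 + ra ^ 2))) (by positivity)
  rwa [div_mul_cancel₀ _ hQ.ne'] at this

lemma phi_D2 {n : ℕ} {p α a : ℝ} {φ : ℝ → ℝ} (hφ : IsSteadyStateA n p α φ a) {r : ℝ} (hr : 0 < r) :
    ∃ d1 d2, D2 φ r d1 d2 ∧ d1 ≤ 0 ∧ d2 + ((n : ℝ) - 1) / r * d1 + φ r ^ p = 0 := by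
  refine ⟨_, _, D2.of_contDiffOn hφ.smooth (Ioi_mem_nhds hr), ?_, hφ.ode r hr⟩
  have h := (D2.of_contDiffOn hφ.smooth (Ioi_mem_nhds hr)).hasDerivAt
  have := left_test h.neg (by
    have : ∀ᶠ s in nhdsWithin r (Iio r), 0 < s := nhdsWithin_le_nhds (lt_mem_nhds hr)
    filter_upwards [self_mem_nhdsWithin, this] with s hs hs0
    have := hφ.anti (mem_Ici.2 hs0.le) (mem_Ici.2 hr.le) hs
    simp only [Pi.neg_apply]; linarith)
  linarith

lemma phi_exp {n : ℕ} {p α a : ℝ} {φ : ℝ → ℝ} (hφ : IsSteadyStateA n p α φ a) {η : ℝ} (hη : 0 < η) :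
    ∃ R > (0:ℝ), ∀ r ≥ R, |φ r - (Sst n p r - a * r ^ (-nuExp p - lam1 n p))|
      ≤ η * r ^ (-nuExp p - lam1 n p) := by
  have h := hφ.expansion.def hη
  obtain ⟨R, hR⟩ := (h.and (eventually_gt_atTop 0)).exists_forall_of_atTop
  refine ⟨max R 1, by positivity, fun r hr => ?_⟩
  have hr0 : 0 < r := lt_of_lt_of_le one_pos ((le_max_right _ _).trans hr)
  have := (hR r ((le_max_left _ _).trans hr)).1
  rw [Real.norm_eq_abs, Real.norm_eq_abs, abs_of_nonneg (Real.rpow_nonneg hr0.le _)] at this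
  exact this

/-- `r ^ (-b)` is eventually below `η r ^ (-a)` when `a < b`. -/
lemma pow_small {a b : ℝ} (hab : a < b) {η : ℝ} (hη : 0 < η) :
    ∃ R > (0:ℝ), ∀ r ≥ R, r ^ (-b) ≤ η * r ^ (-a) := by
  have h := (tendsto_rpow_neg_atTop (y := b - a) (by linarith)).eventually (ge_mem_nhds hη)
  obtain ⟨R, hR⟩ := h.exists_forall_of_atTop
  refine ⟨max R 1, by positivity, fun r hr => ?_⟩
  have hr0 : 0 < r := lt_of_lt_of_le one_pos ((le_max_right _ _).trans hr)
  have h1 := hR r ((le_max_left _ _).trans hr)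
  have e : r ^ (-b) = r ^ (-(b - a)) * r ^ (-a) := by
    rw [← Real.rpow_add hr0]; congr 1; ring
  rw [e]
  exact mul_le_mul_of_nonneg_right h1 (Real.rpow_nonneg hr0.le _)

lemma phi_low {n : ℕ} {p α a : ℝ} {φ : ℝ → ℝ} (hφ : IsSteadyStateA n p α φ a)
    (hL : 0 < Lconst n p) (hlam : 0 < lam1 n p) {η : ℝ} (hη : 0 < η) :
    ∃ R > (0:ℝ), ∀ r ≥ R, (1 - η) * Sst n p r ≤ φ r := by
  obtain ⟨R1, hR1, h1⟩ := phi_exp hφ hφ.a_pos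
  have ha := hφ.a_pos
  obtain ⟨R2, hR2, h2⟩ := pow_small (a := nuExp p) (b := nuExp p + lam1 n p) (by linarith)
    (η := η * Lconst n p / (2 * a)) (by positivity)
  refine ⟨max R1 R2, by positivity, fun r hr => ?_⟩
  have h1 := (abs_le.1 (h1 r ((le_max_left _ _).trans hr))).1
  have h2 := h2 r ((le_max_right _ _).trans hr)
  have e : -(nuExp p + lam1 n p) = -nuExp p - lam1 n p := by ring
  rw [e] at h2
  have h3 : 2 * a * r ^ (-nuExp p - lam1 n p) ≤ η * Sst n p r := by
    have := mul_le_mul_of_nonneg_left h2 (by positivity : 0 ≤ 2 * a)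
    refine this.trans (le_of_eq ?_)
    unfold Sst; field_simp
  linarith

lemma phi_c {n : ℕ} {p α a : ℝ} {φ : ℝ → ℝ} (hφ : IsSteadyStateA n p α φ a) (hp : 1 < p)
    (hL : 0 < Lconst n p) (hlam : 0 < lam1 n p) :
    ∃ c > (0:ℝ), ∀ r > (0:ℝ), c ≤ φ r ^ (p - 1) * (1 + r ^ 2) := by
  obtain ⟨R, hR, h⟩ := phi_low hφ hL hlam (η := 1 / 2) (by norm_num)
  have hφR := hφ.pos R hR.le
  refine ⟨min (φ R ^ (p - 1)) ((1 / 2) ^ (p - 1) * Lconst n p ^ (p - 1)), lt_min (by positivity) (by positivity),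
    fun r hr => ?_⟩
  rcases le_total r R with hrR | hrR
  · refine (min_le_left _ _).trans ?_
    have h1 : φ R ≤ φ r := hφ.anti.antitoneOn (mem_Ici.2 hr.le) (mem_Ici.2 hR.le) hrR
    have h2 : φ R ^ (p - 1) ≤ φ r ^ (p - 1) := Real.rpow_le_rpow hφR.le h1 (by linarith)
    have : 0 < φ R ^ (p - 1) := by positivity
    nlinarith [sq_nonneg r]
  · refine (min_le_right _ _).trans ?_
    have h1 := h r hrR
    have hS := S_pos (n := n) (p := p) hL hr
    have h2 : ((1 - 1 / 2) * Sst n p r) ^ (p - 1) ≤ φ r ^ (p - 1) :=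
      Real.rpow_le_rpow (by positivity) h1 (by linarith)
    rw [Real.mul_rpow (by norm_num) hS.le, S_pow hp hL hr] at h2
    have h3 : ((1:ℝ) - 1 / 2) = 1 / 2 := by norm_num
    rw [h3] at h2
    set q := (1 / 2 : ℝ) ^ (p - 1)
    set l := Lconst n p ^ (p - 1)
    have hq : 0 < q * l := by positivity
    have h4 : q * (l / r ^ 2) * (1 + r ^ 2) ≤ φ r ^ (p - 1) * (1 + r ^ 2) :=
      mul_le_mul_of_nonneg_right h2 (by positivity)
    refine le_trans ?_ h4
    have : q * (l / r ^ 2) * (1 + r ^ 2) = q * l + q * l / r ^ 2 := by field_simp; ring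
    rw [this]
    have : 0 < q * l / r ^ 2 := by positivity
    linarith

/-- cut-off profile -/
def Fc (x : ℝ) : ℝ := (4 / (1 + x) - 1) / 3

lemma Fc_D2 {x : ℝ} (hx : 0 ≤ x) :
    D2 Fc x (-(4 / 3) * (1 / (1 + x)) ^ 2) (8 / 3 * (1 / (1 + x)) ^ 3) := by
  refine ⟨fun y => -(4 / 3) * (1 / (1 + y)) ^ 2, ?_, rfl, ?_⟩
  · have : ∀ᶠ y in nhds x, -1 < y := lt_mem_nhds (by linarith)
    filter_upwards [this] with y hy
    have hy' : 1 + y ≠ 0 := by linarith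
    have := ((((hasDerivAt_id y).const_add 1).inv hy').const_mul 4).sub_const 1 |>.div_const 3
    refine (this.congr_deriv ?_).congr_of_eventuallyEq ?_
    · simp only [id]; field_simp
    · exact Eventually.of_forall fun z => by simp [Fc, div_eq_mul_inv]
  · have hy' : 1 + x ≠ 0 := by linarith
    have := ((((hasDerivAt_id x).const_add 1).inv hy').pow 2).const_mul (-(4/3))
    refine (this.congr_deriv ?_).congr_of_eventuallyEq ?_
    · simp only [id, Pi.inv_apply]; field_simp; norm_num; field_simp
    · exact Eventually.of_forall fun z => by simp [div_eq_mul_inv]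

lemma algA3 {N ℓ φ P r G F Fp : ℝ} (hN : 10 < N) (hℓ : ℓ ≤ N ^ 2) (hφ : 0 < φ)
    (hr : 0 < r) (hP0 : 0 ≤ P) (hP : P ≤ ℓ / r ^ 2) (hF : F = (4 * G - 1) / 3) (hF0 : 0 ≤ F) (hFp : 0 ≤ Fp)
    (hG : G ≤ 3 / 8) :
    0 ≤ P * φ * (Fp - F) + φ * (4 / 3 * G * (1 - G) * (8 * N) * (7 * N + 2 - 16 * N * G)) / r ^ 2 := by
  have hG1 : 1 / 4 ≤ G := by linarith
  have h1 : 5 / 32 ≤ G * (1 - G) := by nlinarith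
  have h2 : N ≤ 7 * N + 2 - 16 * N * G := by nlinarith
  have h3 : N ^ 2 ≤ 4 / 3 * G * (1 - G) * (8 * N) * (7 * N + 2 - 16 * N * G) := by
    have : 5 / 32 * N ≤ G * (1 - G) * (7 * N + 2 - 16 * N * G) :=
      mul_le_mul h1 h2 (by linarith) (by linarith)
    nlinarith
  have h4 : P * F ≤ N ^ 2 / r ^ 2 := by
    have hF1 : F ≤ 1 := by linarith
    calc P * F ≤ P * 1 := mul_le_mul_of_nonneg_left hF1 hP0
      _ ≤ ℓ / r ^ 2 := by linarith
      _ ≤ N ^ 2 / r ^ 2 := by gcongr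
  set Λ := 4 / 3 * G * (1 - G) * (8 * N) * (7 * N + 2 - 16 * N * G)
  have h5 : N ^ 2 / r ^ 2 ≤ Λ / r ^ 2 := by gcongr
  have h6 : 0 ≤ φ * (Λ / r ^ 2 - P * F) := mul_nonneg hφ.le (by linarith)
  have h7 : 0 ≤ P * φ * Fp := by positivity
  have : φ * Λ / r ^ 2 = φ * (Λ / r ^ 2) := by ring
  rw [this]
  linarith

lemma algA2 {N φ P r G F Fp p K Y c : ℝ} (hN : 10 < N) (hφ : 0 < φ) (hp : 1 < p)
    (hr : 0 < r) (hc : 0 < c) (hP0 : c / 2 / r ^ 2 ≤ P) (hF : F = (4 * G - 1) / 3)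
    (hFp : 1 + p * (F - 1) ≤ Fp) (hG : 3 / 8 ≤ G) (hG1 : G ≤ 1)
    (hK : (144 * N ^ 2 / c + 8 / 3 * (p - 1)) * P ≤ K * p * Y) :
    0 ≤ P * φ * (Fp - F) + φ * (4 / 3 * G * (1 - G) * (8 * N) * (7 * N + 2 - 16 * N * G)) / r ^ 2
      + 4 / 3 * K * p * Y * φ * G * (1 - G) := by
  have hP : 0 < P := lt_of_lt_of_le (by positivity) hP0
  have h1 : -((p - 1) * (4 / 3) * (1 - G) * (8 / 3 * G)) ≤ Fp - F := by
    have : (1 - G) * 1 ≤ (1 - G) * (8 / 3 * G) := mul_le_mul_of_nonneg_left (by linarith) (by linarith)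
    have : (p - 1) * ((1 - G) * 1) ≤ (p - 1) * ((1 - G) * (8 / 3 * G)) :=
      mul_le_mul_of_nonneg_left this (by linarith)
    have : Fp - F ≥ -((p - 1) * (1 - F)) := by linarith
    have e : 1 - F = 4 / 3 * (1 - G) := by rw [hF]; ring
    rw [e] at this
    linarith
  have h2 : -(9 * N) ≤ 7 * N + 2 - 16 * N * G := by nlinarith
  have h3 : 1 / r ^ 2 ≤ 2 / c * P := by
    have := mul_le_mul_of_nonneg_left hP0 (by positivity : 0 ≤ 2 / c)
    refine le_trans (le_of_eq ?_) this
    field_simp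
  have hGG : 0 ≤ G * (1 - G) := mul_nonneg (by linarith) (by linarith)
  -- factor 4/3 φ G(1-G)
  have h4 : -(144 * N ^ 2 / c * P) ≤ 8 * N * (7 * N + 2 - 16 * N * G) / r ^ 2 := by
    have a1 : -(72 * N ^ 2) ≤ 8 * N * (7 * N + 2 - 16 * N * G) := by nlinarith
    have a2 : -(72 * N ^ 2) / r ^ 2 ≤ 8 * N * (7 * N + 2 - 16 * N * G) / r ^ 2 := by gcongr
    have a3 : 72 * N ^ 2 * (1 / r ^ 2) ≤ 72 * N ^ 2 * (2 / c * P) :=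
      mul_le_mul_of_nonneg_left h3 (by positivity)
    have e1 : -(72 * N ^ 2) / r ^ 2 = - (72 * N ^ 2 * (1 / r ^ 2)) := by ring
    have e2 : 72 * N ^ 2 * (2 / c * P) = 144 * N ^ 2 / c * P := by ring
    linarith
  have h5 : P * φ * (-((p - 1) * (4 / 3) * (1 - G) * (8 / 3 * G))) ≤ P * φ * (Fp - F) :=
    mul_le_mul_of_nonneg_left h1 (by positivity)
  have h6 : 0 ≤ (4 / 3 * φ * (G * (1 - G))) *
      (8 * N * (7 * N + 2 - 16 * N * G) / r ^ 2 + K * p * Y - 8 / 3 * (p - 1) * P) :=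
    mul_nonneg (by positivity) (by linarith)
  have e3 : φ * (4 / 3 * G * (1 - G) * (8 * N) * (7 * N + 2 - 16 * N * G)) / r ^ 2
    = (4 / 3 * φ * (G * (1 - G))) * (8 * N * (7 * N + 2 - 16 * N * G) / r ^ 2) := by ring
  rw [e3]
  nlinarith

lemma algA1 {N φ α P Pα r G F Fp p w A B δ ξ : ℝ} (hN : 10 < N) (hφ : 0 < φ) (hφα : φ ≤ α) (hp : 1 < p)
    (hr : 0 < r) (hr1 : r ≤ 1) (hP0 : 0 ≤ P) (hPα : P ≤ Pα) (hF : F = (4 * G - 1) / 3)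
    (hFp : 1 + p * (F - 1) ≤ Fp) (hG0 : 0 ≤ G) (hG1 : G ≤ 1) (hGξ : 1 - G ≤ ξ) (hw : δ ≤ w)
    (hAB : B < A) (hξ : ξ * (4 / 3 * (Pα * α * (p - 1) + 72 * N ^ 2 * α)) < (A - B) * δ) :
    0 < P * φ * (Fp - F) + φ * (4 / 3 * G * (1 - G) * (8 * N) * (7 * N + 2 - 16 * N * G)) / r ^ 2
      + (A - B) * w / r ^ 2 := by
  have hr2 : r ^ 2 ≤ 1 := by nlinarith
  have hr20 : 0 < r ^ 2 := by positivity
  have e : 1 - F = 4 / 3 * (1 - G) := by rw [hF]; ring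
  have hξ0 : 0 ≤ ξ := by linarith
  have h1 : -((p - 1) * (4 / 3 * ξ)) ≤ Fp - F := by
    have : (p - 1) * (1 - F) ≤ (p - 1) * (4 / 3 * ξ) :=
      mul_le_mul_of_nonneg_left (by linarith) (by linarith)
    linarith
  have h2 : -(9 * N) ≤ 7 * N + 2 - 16 * N * G := by nlinarith
  have h3 : -(4 / 3 * ξ * 72 * N ^ 2) ≤ 4 / 3 * G * (1 - G) * (8 * N) * (7 * N + 2 - 16 * N * G) := by
    have a1 : G * (1 - G) ≤ ξ := by nlinarith
    have a0 : 0 ≤ G * (1 - G) := mul_nonneg hG0 (by linarith)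
    have a2 : -(72 * N ^ 2) ≤ 8 * N * (7 * N + 2 - 16 * N * G) := by nlinarith
    have a3 : (G * (1 - G)) * (-(72 * N ^ 2)) ≤ (G * (1 - G)) * (8 * N * (7 * N + 2 - 16 * N * G)) :=
      mul_le_mul_of_nonneg_left a2 a0
    have a4 : G * (1 - G) * (72 * N ^ 2) ≤ ξ * (72 * N ^ 2) :=
      mul_le_mul_of_nonneg_right a1 (by positivity)
    nlinarith
  have hα : 0 < α := by linarith
  have h4 : P * φ ≤ Pα * α := mul_le_mul hPα hφα hφ.le (by linarith)
  have h5 : -(Pα * α * ((p - 1) * (4 / 3 * ξ))) ≤ P * φ * (Fp - F) := by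
    have b1 : P * φ * (-((p - 1) * (4 / 3 * ξ))) ≤ P * φ * (Fp - F) :=
      mul_le_mul_of_nonneg_left h1 (by positivity)
    have b2 : P * φ * ((p - 1) * (4 / 3 * ξ)) ≤ Pα * α * ((p - 1) * (4 / 3 * ξ)) :=
      mul_le_mul_of_nonneg_right h4 (mul_nonneg (by linarith) (by positivity))
    linarith
  have h6 : -(α * (4 / 3 * ξ * 72 * N ^ 2)) ≤ φ * (4 / 3 * G * (1 - G) * (8 * N) * (7 * N + 2 - 16 * N * G)) := by
    have b1 := mul_le_mul_of_nonneg_left h3 hφ.le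
    have b2 : φ * (4 / 3 * ξ * 72 * N ^ 2) ≤ α * (4 / 3 * ξ * 72 * N ^ 2) :=
      mul_le_mul_of_nonneg_right hφα (by positivity)
    linarith
  set Λ := φ * (4 / 3 * G * (1 - G) * (8 * N) * (7 * N + 2 - 16 * N * G))
  have h7 : (A - B) * δ ≤ (A - B) * w := mul_le_mul_of_nonneg_left hw (by linarith)
  have h8 : 0 < Λ + (A - B) * w - Pα * α * ((p - 1) * (4 / 3 * ξ)) := by linarith
  have h9 : 0 ≤ Pα * α * ((p - 1) * (4 / 3 * ξ)) := by
    have : 0 ≤ Pα := by linarith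
    exact mul_nonneg (by positivity) (mul_nonneg (by linarith) (by positivity))
  have h10 : Pα * α * ((p - 1) * (4 / 3 * ξ)) ≤ Pα * α * ((p - 1) * (4 / 3 * ξ)) / r ^ 2 :=
    le_div_self h9 hr20 hr2
  have h11 : 0 < (Λ + (A - B) * w - Pα * α * ((p - 1) * (4 / 3 * ξ))) / r ^ 2 := by positivity
  have e2 : (Λ + (A - B) * w - Pα * α * ((p - 1) * (4 / 3 * ξ))) / r ^ 2
    = Λ / r ^ 2 + (A - B) * w / r ^ 2 - Pα * α * ((p - 1) * (4 / 3 * ξ)) / r ^ 2 := by ring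
  linarith

lemma algI {N φr F a1 a2 G X κ r δ γ w A ℓ p P K Y Fp yp g2 : ℝ} (hr : 0 < r) (hφ : 0 < φr)
    (hG0 : 0 < G) (hX : 0 < X) (hκ0 : 0 < κ) (hκ : κ = 8 * N) (hGX : X * G = 1 - G) (ha1 : a1 ≤ 0)
    (hode : a2 + (N - 1) / r * a1 + P * φr = 0)
    (hlw : -γ * (-γ - 1) * g2 / r ^ 2 + (N - 1) / r * (-γ * g2 / r) = - (A * g2 / r ^ 2))
    (hw : w = δ * g2)
    (hconv : P * φr * Fp - yp ≤ p * (ℓ / r ^ 2) * w)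
    (htl : (a2 * F + 2 * a1 * (-(4 / 3) * G ^ 2 * (κ * X / r))
       + φr * (8 / 3 * G ^ 3 * (κ * X / r) ^ 2 + -(4 / 3) * G ^ 2 * (κ * (κ - 1) * X / r ^ 2))
        - δ * (-γ * (-γ - 1) * g2 / r ^ 2))
      + (N - 1) / r * (a1 * F + φr * (-(4 / 3) * G ^ 2 * (κ * X / r)) - δ * (-γ * g2 / r))
      + yp ≤ p * Y * (φr * (-(4 / 3) * G ^ 2 * (K * X)))) :
    P * φr * (Fp - F) + φr * (4 / 3 * G * (1 - G) * (8 * N) * (7 * N + 2 - 16 * N * G)) / r ^ 2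
      + (A - p * ℓ) * w / r ^ 2 + 4 / 3 * K * p * Y * φr * G * (1 - G) ≤ 0 := by
  have hFL : 8 / 3 * G ^ 3 * (κ * X / r) ^ 2 + -(4 / 3) * G ^ 2 * (κ * (κ - 1) * X / r ^ 2)
      + (N - 1) / r * (-(4 / 3) * G ^ 2 * (κ * X / r))
      = (4 / 3 * G * (1 - G) * (8 * N) * (7 * N + 2 - 16 * N * G)) / r ^ 2 := by
    have : X = (1 - G) / G := by rw [← hGX]; field_simp
    rw [this, hκ]
    field_simp
    ring
  have hcross : 0 ≤ 2 * a1 * (-(4 / 3) * G ^ 2 * (κ * X / r)) := by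
    have h : 0 ≤ 2 * (4 / 3) * G ^ 2 * (κ * X / r) := by positivity
    have := mul_nonneg (neg_nonneg.2 ha1) h
    linarith only [this]
  have e2 : p * Y * (φr * (-(4 / 3) * G ^ 2 * (K * X))) = -(4 / 3 * K * p * Y * φr * G * (1 - G)) := by
    rw [← hGX]; ring
  have e3 : φr * (4 / 3 * G * (1 - G) * (8 * N) * (7 * N + 2 - 16 * N * G)) / r ^ 2
      = φr * (8 / 3 * G ^ 3 * (κ * X / r) ^ 2 + -(4 / 3) * G ^ 2 * (κ * (κ - 1) * X / r ^ 2))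
      + (N - 1) / r * (φr * (-(4 / 3) * G ^ 2 * (κ * X / r))) := by rw [mul_div_assoc, ← hFL]; ring
  have e4 : (A - p * ℓ) * w / r ^ 2 = A * w / r ^ 2 - p * (ℓ / r ^ 2) * w := by ring
  have e5 : δ * (-γ * (-γ - 1) * g2 / r ^ 2) + (N - 1) / r * (δ * (-γ * g2 / r)) = - (A * w / r ^ 2) := by
    rw [hw]; linear_combination δ * hlw
  have e6 : a2 * F + (N - 1) / r * (a1 * F) = - (P * φr * F) := by linear_combination F * hode
  rw [e3, e4]
  have e7 : (N - 1) / r * (a1 * F + φr * (-(4 / 3) * G ^ 2 * (κ * X / r)) - δ * (-γ * g2 / r))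
    = (N - 1) / r * (a1 * F) + (N - 1) / r * (φr * (-(4 / 3) * G ^ 2 * (κ * X / r))) - (N - 1) / r * (δ * (-γ * g2 / r)) := by ring
  rw [e2, e7] at htl
  rw [mul_sub]
  linarith only [htl, hcross, e5, e6, hconv]

set_option maxHeartbeats 1000000 in
lemma lower_comp {n : ℕ} (hn : 10 < n) {p α a γ : ℝ} {φ v₀ : ℝ → ℝ} {v : ℝ → ℝ → ℝ}
    (hφ : IsSteadyStateA n p α φ a) (hv : IsRadialSol n p v v₀) (hp : 1 < p)
    (hν : 0 < nuExp p) (h2ν : 2 * nuExp p < (n : ℝ) - 2) (hL : 0 < Lconst n p)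
    (hL2 : Lconst n p ^ (p - 1) = nuExp p * ((n : ℝ) - 2 - nuExp p)) (hlam : 0 < lam1 n p)
    (hγν : nuExp p < γ)
    (hAB : p * Lconst n p ^ (p - 1) < γ * ((n : ℝ) - 2 - γ))
    (hge : ∀ r > (0:ℝ), φ r ≤ v r 0) :
    ∀ r > (0:ℝ), ∀ t ≥ (0:ℝ), φ r ≤ v r t := by
  intro ra hra ta hta
  have hN : (10:ℝ) < n := by exact_mod_cast hn
  set N : ℝ := (n:ℝ) with hNdef
  set ν := nuExp p with hνdef
  set ℓ := Lconst n p ^ (p - 1) with hℓdef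
  have hℓ : ℓ ≤ N ^ 2 := by rw [hL2]; nlinarith
  have hℓ0 : 0 < ℓ := by positivity
  have hα : 0 < α := by have := hφ.pos 0 le_rfl; rwa [hφ.val0] at this
  obtain ⟨c, hc, hφc⟩ := phi_c hφ hp hL hlam
  set A := γ * (N - 2 - γ) with hA
  set T := ta + 1 with hT
  -- constants
  set c1 := (c / 2) ^ (1 / (p - 1)) with hc1
  have hc10 : 0 < c1 := by positivity
  have hPr : ∀ r ≥ (1:ℝ), c / 2 / r ^ 2 ≤ φ r ^ (p - 1) := by
    intro r hr
    have hr0 : 0 < r := by linarith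
    have h := hφc r hr0
    have hφr : 0 < φ r ^ (p - 1) := Real.rpow_pos_of_pos (hφ.pos r hr0.le) _
    rw [div_div, div_le_iff₀ (by positivity)]
    have : φ r ^ (p - 1) * (1 + r ^ 2) ≤ φ r ^ (p - 1) * (2 * r ^ 2) :=
      mul_le_mul_of_nonneg_left (by nlinarith) hφr.le
    linarith
  have hφlow : ∀ r ≥ (1:ℝ), c1 * r ^ (-γ) ≤ φ r := by
    intro r hr
    have hr0 : 0 < r := by linarith
    have h1 : r ^ (-γ) ≤ r ^ (-ν) := Real.rpow_le_rpow_of_exponent_le hr (by linarith)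
    refine (mul_le_mul_of_nonneg_left h1 hc10.le).trans ?_
    have h2 : (c1 * r ^ (-ν)) ^ (p - 1) ≤ φ r ^ (p - 1) := by
      refine le_trans (le_of_eq ?_) (hPr r hr)
      rw [Real.mul_rpow hc10.le (Real.rpow_nonneg hr0.le _), ← Real.rpow_mul hr0.le, hc1,
        ← Real.rpow_mul (by positivity), one_div_mul_cancel (by linarith), Real.rpow_one]
      have : -ν * (p - 1) = -(2 : ℝ) := by rw [neg_mul, hνdef, par_nu hp]
      rw [this, Real.rpow_neg hr0.le]
      norm_num [div_eq_mul_inv]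
    exact (Real.rpow_le_rpow_iff (by positivity) (hφ.pos r hr0.le).le (by linarith)).1 h2
  set q := (1 / 12 : ℝ) ^ (p - 1) with hq
  have hq0 : 0 < q := by positivity
  set K := (144 * N ^ 2 / c + 8 / 3 * (p - 1)) / (p * q) with hK
  have hp0 : 0 < p := by linarith
  have hp10 : 0 < p - 1 := by linarith
  have hK0 : 0 < K := by positivity
  have hKe : K * p * q = 144 * N ^ 2 / c + 8 / 3 * (p - 1) := by rw [hK]; field_simp
  set κ := 8 * N with hκ
  have key : ∀ δ > (0:ℝ), δ ≤ c1 / 12 → ∀ ε > (0:ℝ),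
      ε * Real.exp (K * T) * (4 / 3 * (α ^ (p - 1) * α * (p - 1) + 72 * N ^ 2 * α))
        < (A - p * ℓ) * δ →
      φ ra * Fc (ε * Real.exp (K * ta) * ra ^ κ) - δ * ra ^ (-γ) ≤ v ra ta := by
    intro δ hδ hδ1 ε hε hεs
    have hγ0 : 0 < γ := by linarith
    -- inner radius
    obtain ⟨r1, hr10, hr1a, hr1⟩ : ∃ r1 > (0:ℝ), r1 ≤ ra ∧ α < δ * r1 ^ (-γ) := by
      have h1 : Tendsto (fun r : ℝ => δ * r ^ (-γ)) (nhdsWithin 0 (Ioi 0)) atTop :=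
        (tendsto_rpow_neg_nhdsGT_zero (by linarith)).const_mul_atTop hδ
      have h2 := (h1.eventually (eventually_gt_atTop α)).and
        ((Ioc_mem_nhdsGT hra : Ioc 0 ra ∈ nhdsWithin (0:ℝ) (Ioi 0)))
      obtain ⟨r, h3, h4⟩ := h2.exists
      exact ⟨r, h4.1, h4.2, h3⟩
    obtain ⟨r2, hr2a, hr2⟩ : ∃ r2, ra ≤ r2 ∧ 3 < ε * r2 ^ κ := by
      have h1 : Tendsto (fun r : ℝ => ε * r ^ κ) atTop atTop :=
        (tendsto_rpow_atTop (by positivity)).const_mul_atTop hε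
      obtain ⟨r, h3, h4⟩ := ((h1.eventually (eventually_gt_atTop 3)).and (eventually_ge_atTop ra)).exists
      exact ⟨r, h4, h3⟩
    have hX0 : ∀ r > (0:ℝ), ∀ t : ℝ, 0 < ε * Real.exp (K * t) * r ^ κ := fun r hr t => by positivity
    have hF1 : ∀ x > (0:ℝ), Fc x ≤ 1 := by
      intro x hx
      unfold Fc
      have : 4 / (1 + x) ≤ 4 := by apply div_le_self <;> linarith
      linarith
    have hft := first_touch (f := fun r t => φ r * Fc (ε * Real.exp (K * t) * r ^ κ) - δ * r ^ (-γ) - v r t)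
      (r1 := r1) (r2 := r2) (T0 := 0) (T1 := T)
      ?_ ?_ ?_ ?_ ?_ ra ⟨hr1a, hr2a⟩ ta ⟨hta, by simp [T]⟩
    · linarith
    · have s2 : Icc r1 r2 ×ˢ Icc 0 T ⊆ Ici (0:ℝ) ×ˢ Ici (0:ℝ) := by
        rintro ⟨x, y⟩ ⟨hx, hy⟩
        exact ⟨hr10.le.trans hx.1, hy.1⟩
      have s3 : ∀ x ∈ Icc r1 r2 ×ˢ Icc (0:ℝ) T, 0 < x.1 := fun x hx => lt_of_lt_of_le hr10 hx.1.1
      have c1 := hv.cont.mono s2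
      have c3 : ContinuousOn (fun q : ℝ × ℝ => φ q.1) (Icc r1 r2 ×ˢ Icc 0 T) :=
        hφ.cont.comp continuousOn_fst (fun q hq => (s2 hq).1)
      have c4 : ContinuousOn (fun q : ℝ × ℝ => ε * Real.exp (K * q.2) * q.1 ^ κ) (Icc r1 r2 ×ˢ Icc 0 T) := by
        apply ContinuousOn.mul (by fun_prop)
        exact continuousOn_fst.rpow_const (fun x hx => Or.inl (s3 x hx).ne')
      have c5 : ContinuousOn (fun q : ℝ × ℝ => Fc (ε * Real.exp (K * q.2) * q.1 ^ κ)) (Icc r1 r2 ×ˢ Icc 0 T) := by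
        unfold Fc
        refine ((continuousOn_const.div (continuousOn_const.add c4) ?_).sub continuousOn_const).div_const _
        intro x hx
        have := hX0 x.1 (s3 x hx) x.2
        exact (show (0:ℝ) < 1 + ε * Real.exp (K * x.2) * x.1 ^ κ by linarith).ne'
      have c6 : ContinuousOn (fun q : ℝ × ℝ => δ * q.1 ^ (-γ)) (Icc r1 r2 ×ˢ Icc 0 T) :=
        continuousOn_const.mul (continuousOn_fst.rpow_const (fun x hx => Or.inl (s3 x hx).ne'))
      exact ((c3.mul c5).sub c6).sub c1
    · intro r hr
      have hr0 : 0 < r := lt_of_lt_of_le hr10 hr.1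
      have h1 := hge r hr0
      have h2 := hF1 _ (hX0 r hr0 0)
      have h3 := hφ.pos r hr0.le
      have : 0 < δ * r ^ (-γ) := by positivity
      have h4 := mul_le_mul_of_nonneg_left h2 h3.le
      show _ - _ - _ < 0
      linarith only [h1, h4, this]
    · intro t ht
      have h2 := hF1 _ (hX0 r1 hr10 t)
      have h3 := hφ.pos r1 hr10.le
      have h4 : φ r1 ≤ α := by
        rw [← hφ.val0]; exact hφ.anti.antitoneOn (mem_Ici.2 le_rfl) (mem_Ici.2 hr10.le) hr10.le
      have h5 := hv.nonneg r1 hr10.le t ht.1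
      have h6 := mul_le_mul_of_nonneg_left h2 h3.le
      show _ - _ - _ < 0
      linarith only [h4, h5, h6, hr1]
    · intro t ht
      have hr20 : 0 < r2 := by linarith
      have h3 := hφ.pos r2 hr20.le
      have h5 := hv.nonneg r2 hr20.le t ht.1
      have h6 : 3 < ε * Real.exp (K * t) * r2 ^ κ := by
        have : 1 ≤ Real.exp (K * t) := Real.one_le_exp (mul_nonneg hK0.le ht.1)
        have h7 : 0 < ε * r2 ^ κ := by positivity
        have := mul_le_mul_of_nonneg_left this h7.le
        linarith only [this, hr2]
      have h7 : Fc (ε * Real.exp (K * t) * r2 ^ κ) ≤ 0 := by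
        unfold Fc
        have : 4 / (1 + ε * Real.exp (K * t) * r2 ^ κ) ≤ 1 := by
          rw [div_le_one (by linarith)]; linarith
        linarith
      have : 0 < δ * r2 ^ (-γ) := by positivity
      have h8 := mul_nonpos_of_nonneg_of_nonpos h3.le h7
      show _ - _ - _ < 0
      linarith only [h8, h5, this]
    · intro r hr t ht heq hsp htm
      have hr0 : 0 < r := lt_trans hr10 hr.1
      obtain ⟨a1, a2, hDa, ha1, hode⟩ := phi_D2 hφ hr0
      set X := ε * Real.exp (K * t) * r ^ κ with hX
      have hXp : 0 < X := hX0 r hr0 t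
      set G := 1 / (1 + X) with hG
      have hGX : X * G = 1 - G := by rw [hG]; field_simp; ring
      have hG0 : 0 < G := by positivity
      have hG1 : G ≤ 1 := by have := mul_pos hXp hG0; linarith only [this, hGX]
      set F := Fc X with hF
      have hFG : F = (4 * G - 1) / 3 := by rw [hF, hG]; unfold Fc; ring
      have hDX : D2 (fun ρ => ε * Real.exp (K * t) * ρ ^ κ) r (κ * X / r) (κ * (κ - 1) * X / r ^ 2) := by
        have := (D2.rpow hr0 κ).const_mul (ε * Real.exp (K * t))
        convert this using 1 <;> rw [hX] <;> ring
      have hDF := D2.comp (g := Fc) (f := fun ρ => ε * Real.exp (K * t) * ρ ^ κ) (Fc_D2 hXp.le) hDX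
      have hDψ := (hDa.mul hDF).sub ((D2.rpow hr0 (-γ)).const_mul δ)
      have hTX : HasDerivAt (fun s => ε * Real.exp (K * s) * r ^ κ) (K * X) t := by
        have := (((hasDerivAt_id t).const_mul K).exp.const_mul ε).mul_const (r ^ κ)
        refine this.congr_deriv ?_
        simp only [hX, id]; ring
      have hTF := ((((Fc_D2 hXp.le).hasDerivAt.comp t hTX)).const_mul (φ r)).sub_const (δ * r ^ (-γ))
      have hFanti : ∀ x y : ℝ, 0 < x → x ≤ y → Fc y ≤ Fc x := by
        intro x y hx hxy
        unfold Fc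
        have : 4 / (1 + y) ≤ 4 / (1 + x) := by gcongr
        linarith
      have hφr := hφ.pos r hr0.le
      have htl := touch_lower hv hp hr0 ht.1
        (Ψ := fun r t => φ r * Fc (ε * Real.exp (K * t) * r ^ κ) - δ * r ^ (-γ))
        hDψ hTF (by linarith) (hsp.mono fun x hx => by linarith)
        (htm.mono fun x hx => by linarith) (by
          intro s hs
          have : Fc X ≤ Fc (ε * Real.exp (K * s) * r ^ κ) := by
            apply hFanti _ _ (hX0 r hr0 s)
            rw [hX]
            gcongr
          have := mul_le_mul_of_nonneg_left this hφr.le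
          simp only [← hX]; linarith)
      simp only [← hX, ← hF, ← hG] at htl
      have hyval : v r t = φ r * F - δ * r ^ (-γ) := by linarith only [heq]
      have hy0 : 0 ≤ φ r * F - δ * r ^ (-γ) := hyval ▸ hv.nonneg r hr0.le t ht.1.le
      set y := φ r * F - δ * r ^ (-γ) with hy
      set w := δ * r ^ (-γ) with hw
      have hw0 : 0 < w := by positivity
      have hφF : 0 < φ r * F := by linarith
      have hF0 : 0 < F := by
        by_contra h; push Not at h
        have := mul_nonpos_of_nonneg_of_nonpos hφr.le h; linarith
      have hFle : F ≤ 1 := hF1 X hXp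
      set P := φ r ^ (p - 1) with hP
      have hP0 : 0 < P := Real.rpow_pos_of_pos hφr _
      have hφp : φ r ^ p = P * φ r := by rw [hP, Real.rpow_sub_one hφr.ne']; field_simp
      have hPS : P ≤ ℓ / r ^ 2 := by
        rw [hℓdef, ← S_pow hp hL hr0]
        exact Real.rpow_le_rpow hφr.le (hφ.upper r hr0) hp10.le
      have hconv := pow_conv hp hy0 hφF
      rw [Real.mul_rpow hφr.le hF0.le, Real.mul_rpow hφr.le hF0.le, hφp, ← hP] at hconv
      have e1 : φ r * F - y = w := by rw [hy]; ring
      rw [e1] at hconv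
      have hFq : F ^ (p - 1) ≤ 1 := Real.rpow_le_one hF0.le hFle hp10.le
      have hPF : p * (P * F ^ (p - 1)) * w ≤ p * (ℓ / r ^ 2) * w := by
        have : P * F ^ (p - 1) ≤ P * 1 := mul_le_mul_of_nonneg_left hFq hP0.le
        gcongr; linarith
      have hbern : 1 + p * (F - 1) ≤ F ^ p := by
        have := one_add_mul_self_le_rpow_one_add (s := F - 1) (by linarith) hp.le
        rwa [add_sub_cancel] at this
      set Fp := F ^ p with hFp
      set Y := y ^ (p - 1) with hY
      -- assemble
      have hI : P * φ r * (Fp - F) + φ r * (4 / 3 * G * (1 - G) * (8 * N) * (7 * N + 2 - 16 * N * G)) / r ^ 2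
          + (A - p * ℓ) * w / r ^ 2 + 4 / 3 * K * p * Y * φ r * G * (1 - G) ≤ 0 := by
        have hlw := lap_pow (n := n) (c := -γ) hr0
        refine algI (yp := y ^ p) hr0 hφr hG0 hXp (by positivity) hκ hGX ha1 (by rw [← hφp]; exact hode)
          (g2 := r ^ (-γ)) (δ := δ) (γ := γ) ?_ hw (by linarith only [hconv, hPF]) ?_
        · rw [hlw, hA]; ring
        · exact htl
      have hrest : 0 ≤ 4 / 3 * K * p * Y * φ r * G * (1 - G) := by
        have : 0 ≤ Y := Real.rpow_nonneg hy0 _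
        have : 0 ≤ 1 - G := by linarith
        positivity
      have hAw : 0 < (A - p * ℓ) * w / r ^ 2 := by
        have : 0 < A - p * ℓ := by linarith
        positivity
      rcases le_total r 1 with hr1' | hr1'
      · have hφα : φ r ≤ α := by
          rw [← hφ.val0]; exact hφ.anti.antitoneOn (mem_Ici.2 le_rfl) (mem_Ici.2 hr0.le) hr0.le
        have hXle : X ≤ ε * Real.exp (K * T) := by
          have h1 : r ^ κ ≤ 1 := Real.rpow_le_one hr0.le hr1' (by positivity)
          have h2 : Real.exp (K * t) ≤ Real.exp (K * T) :=
            Real.exp_le_exp.2 (mul_le_mul_of_nonneg_left ht.2 hK0.le)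
          calc X ≤ ε * Real.exp (K * t) * 1 := mul_le_mul_of_nonneg_left h1 (by positivity)
            _ ≤ _ := by rw [mul_one]; gcongr
        have hwδ : δ ≤ w := by
          have : 1 ≤ r ^ (-γ) := Real.one_le_rpow_of_pos_of_le_one_of_nonpos hr0 hr1' (by linarith)
          rw [hw]; exact le_mul_of_one_le_right hδ.le this
        have := algA1 (N := N) (A := A) (B := p * ℓ) hN hφr hφα hp hr0 hr1' hP0.le
          (Real.rpow_le_rpow hφr.le hφα hp10.le) hFG hbern hG0.le hG1
          (ξ := ε * Real.exp (K * T)) (by rw [← hGX]; exact (mul_le_of_le_one_right hXp.le hG1).trans hXle) hwδ hAB hεs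
        linarith only [this, hI, hrest]
      · rcases le_total (3 / 8) G with hG38 | hG38
        · have hwφ : w ≤ φ r / 12 := by
            have h1 := hφlow r hr1'
            have : δ * r ^ (-γ) ≤ c1 / 12 * r ^ (-γ) := by gcongr
            rw [hw]; linarith only [h1, this]
          have hyφ : φ r / 12 ≤ y := by
            have : 1 / 6 ≤ F := by rw [hFG]; linarith only [hG38]
            have := mul_le_mul_of_nonneg_left this hφr.le
            rw [hy]; linarith only [this, hwφ]
          have hYP : q * P ≤ Y := by
            have e : q * P = (φ r / 12) ^ (p - 1) := by
              rw [hq, hP, ← Real.mul_rpow (by norm_num) hφr.le]; congr 1; ring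
            rw [e]
            exact Real.rpow_le_rpow (by positivity) hyφ hp10.le
          have hKY : (144 * N ^ 2 / c + 8 / 3 * (p - 1)) * P ≤ K * p * Y := by
            rw [← hKe]
            have := mul_le_mul_of_nonneg_left hYP (by positivity : 0 ≤ K * p)
            linarith only [this]
          have := algA2 (N := N) hN hφr hp hr0 hc (hPr r hr1') hFG hbern hG38 hG1 hKY
          linarith only [this, hI, hAw]
        · have := algA3 (N := N) hN hℓ hφr hr0 hP0.le hPS hFG hF0.le
            (Real.rpow_nonneg hF0.le p) hG38
          linarith only [this, hI, hAw, hrest]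
  -- limit
  refine le_of_forall_pos_le_add fun η hη => ?_
  set Q1 := ra ^ (-γ) with hQ1
  have hQ10 : 0 < Q1 := by positivity
  set Q2 := φ ra * (4 / 3 * (Real.exp (K * ta) * ra ^ κ)) with hQ2
  have hφra := hφ.pos ra hra.le
  have hQ20 : 0 < Q2 := by positivity
  set δ := min (c1 / 12) (η / 2 / Q1) with hδ
  have hδ0 : 0 < δ := by positivity
  have hδQ : δ * Q1 ≤ η / 2 := by
    rw [← le_div_iff₀ hQ10]; exact min_le_right _ _
  set Q3 := Real.exp (K * T) * (4 / 3 * (α ^ (p - 1) * α * (p - 1) + 72 * N ^ 2 * α)) with hQ3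
  have hQ30 : 0 < Q3 := by positivity
  have hABd : 0 < (A - p * ℓ) * δ := mul_pos (by linarith) hδ0
  set ε := min ((A - p * ℓ) * δ / 2 / Q3) (η / 2 / Q2) with hε
  have hε0 : 0 < ε := by positivity
  have hε1 : ε * Q3 ≤ (A - p * ℓ) * δ / 2 := by
    rw [← le_div_iff₀ hQ30]; exact min_le_left _ _
  have hε2 : ε * Q2 ≤ η / 2 := by
    rw [← le_div_iff₀ hQ20]; exact min_le_right _ _
  have hk := key δ hδ0 (min_le_left _ _) ε hε0 (by
    have : ε * Real.exp (K * T) * (4 / 3 * (α ^ (p - 1) * α * (p - 1) + 72 * N ^ 2 * α)) = ε * Q3 := by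
      rw [hQ3]; ring
    rw [this]; linarith)
  have hX0 : 0 < ε * Real.exp (K * ta) * ra ^ κ := by positivity
  have hFl : 1 - 4 / 3 * (ε * Real.exp (K * ta) * ra ^ κ) ≤ Fc (ε * Real.exp (K * ta) * ra ^ κ) := by
    set X := ε * Real.exp (K * ta) * ra ^ κ
    unfold Fc
    have : 1 - X ≤ 1 / (1 + X) := by
      rw [le_div_iff₀ (by linarith)]; nlinarith
    have e : 4 / (1 + X) = 4 * (1 / (1 + X)) := by ring
    rw [e]; linarith
  have h5 := mul_le_mul_of_nonneg_left hFl hφra.le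
  have e5 : φ ra * (1 - 4 / 3 * (ε * Real.exp (K * ta) * ra ^ κ)) = φ ra - ε * Q2 := by
    rw [hQ2]; ring
  linarith

lemma near0 {C σ M : ℝ} (hC : 0 < C) (hσ : 0 < σ) : ∃ r1 > (0:ℝ), ∀ r ∈ Ioc 0 r1, M < C * r ^ (-σ) := by
  have h1 : Tendsto (fun r : ℝ => C * r ^ (-σ)) (nhdsWithin 0 (Ioi 0)) atTop :=
    (tendsto_rpow_neg_nhdsGT_zero (by linarith)).const_mul_atTop hC
  have h2 := h1.eventually (eventually_gt_atTop M)
  rw [eventually_nhdsWithin_iff, Metric.eventually_nhds_iff] at h2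
  obtain ⟨e, he, h⟩ := h2
  refine ⟨e / 2, by linarith, fun r hr => h ?_ hr.1⟩
  rw [Real.dist_eq, sub_zero, abs_of_pos hr.1]
  linarith [hr.2]

lemma v_le_S {n : ℕ} {p : ℝ} {v₀ : ℝ → ℝ} {v : ℝ → ℝ → ℝ} (hv : IsRadialSol n p v v₀) (hp : 1 < p)
    (hν : 0 < nuExp p) (hL : 0 < Lconst n p)
    (hL2 : Lconst n p ^ (p - 1) = nuExp p * ((n : ℝ) - 2 - nuExp p))
    (hin : ∀ r > (0:ℝ), v r 0 ≤ Sst n p r) : ∀ r > (0:ℝ), ∀ t ≥ (0:ℝ), v r t ≤ Sst n p r := by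
  have h := upper_comp hv hp (ϕ := Sst n p) (fun r hr => S_D2 hp hL hL2 hr) (fun r hr => S_pos hL hr)
    (c := Lconst n p ^ (p - 1)) (by positivity) (fun r hr => by
      rw [S_pow hp hL hr, div_mul_eq_mul_div, le_div_iff₀ (by positivity)]
      have : 0 < Lconst n p ^ (p - 1) := by positivity
      nlinarith) (W := fun _ _ => 0) (t0 := 0) le_rfl (fun _ _ _ _ => le_rfl) continuousOn_const
    (fun r hr t ht => ⟨0, 0, 0, D2.const 0 r, hasDerivAt_const t 0, fun _ => by simp⟩)
    (fun T hT => by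
      obtain ⟨M, hM⟩ := hv.bdd T hT
      obtain ⟨r1, hr1, h⟩ := near0 (M := M) hL hν
      refine ⟨r1, hr1, fun r hr t ht => ?_⟩
      have h1 := h r hr
      have h2 := hM r hr.1.le t ht
      simp only [add_zero, Sst]; linarith)
    (fun r hr => by simpa using hin r hr)
  intro r hr t ht
  simpa using h r hr t ht

lemma vpow_le {n : ℕ} {p : ℝ} (hp : 1 < p) (hL : 0 < Lconst n p) {r x : ℝ} (hr : 0 < r) (hx : 0 ≤ x)
    (hxS : x ≤ Sst n p r) : p * x ^ (p - 1) ≤ p * Lconst n p ^ (p - 1) / r ^ 2 := by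
  have := Real.rpow_le_rpow hx hxS (by linarith : 0 ≤ p - 1)
  rw [S_pow hp hL hr] at this
  rw [mul_div_assoc]
  exact mul_le_mul_of_nonneg_left this (by linarith)

lemma pow_cont {C γ : ℝ} {t0 : ℝ} :
    ContinuousOn (fun q : ℝ × ℝ => C * q.1 ^ (-γ)) (Ioi (0:ℝ) ×ˢ Ici t0) :=
  continuousOn_const.mul (continuousOn_fst.rpow_const (fun x hx => Or.inl (ne_of_gt hx.1)))

lemma pow_D2 {n : ℕ} {C γ r : ℝ} (hr : 0 < r) : ∃ d1 d2, D2 (fun ρ => C * ρ ^ (-γ)) r d1 d2 ∧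
    d2 + ((n : ℝ) - 1) / r * d1 = - (γ * ((n : ℝ) - 2 - γ) * (C * r ^ (-γ)) / r ^ 2) := by
  refine ⟨_, _, (D2.rpow hr (-γ)).const_mul C, ?_⟩
  linear_combination C * lap_pow (n := n) (c := -γ) hr

lemma comp_pow {n : ℕ} {p γ : ℝ} {v₀ : ℝ → ℝ} {v : ℝ → ℝ → ℝ} (hv : IsRadialSol n p v v₀) (hp : 1 < p)
    (hL : 0 < Lconst n p) (hγ : 0 < γ)
    (hAB : p * Lconst n p ^ (p - 1) < γ * ((n : ℝ) - 2 - γ))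
    (hS : ∀ r > (0:ℝ), ∀ t ≥ (0:ℝ), v r t ≤ Sst n p r) {ϕ : ℝ → ℝ}
    (hϕD : ∀ r > (0:ℝ), ∃ d1 d2, D2 ϕ r d1 d2 ∧ d2 + ((n : ℝ) - 1) / r * d1 + ϕ r ^ p = 0)
    (hϕpos : ∀ r > (0:ℝ), 0 < ϕ r) {c : ℝ} (hc : 0 < c)
    (hϕc : ∀ r > (0:ℝ), c ≤ ϕ r ^ (p - 1) * (1 + r ^ 2)) {t0 C : ℝ} (ht0 : 0 ≤ t0) (hC : 0 < C)
    (hin : ∀ r > (0:ℝ), v r t0 ≤ ϕ r + C * r ^ (-γ)) :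
    ∀ r > (0:ℝ), ∀ t ≥ t0, v r t ≤ ϕ r + C * r ^ (-γ) := by
  refine upper_comp hv hp hϕD hϕpos hc hϕc (W := fun r _ => C * r ^ (-γ)) ht0
    (fun r hr t ht => by positivity) pow_cont (fun r hr t ht => ?_) (fun T hT => ?_) hin
  · obtain ⟨d1, d2, hD, he⟩ := pow_D2 (n := n) (C := C) (γ := γ) hr
    refine ⟨d1, d2, 0, hD, hasDerivAt_const _ _, fun _ => ?_⟩
    have ht' : 0 ≤ t := ht0.trans ht.le
    have h1 := vpow_le hp hL hr (hv.nonneg r hr.le t ht') (hS r hr t ht')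
    have hw : 0 < C * r ^ (-γ) := by positivity
    have h2 : p * Lconst n p ^ (p - 1) / r ^ 2 ≤ γ * ((n : ℝ) - 2 - γ) / r ^ 2 := by gcongr
    have h3 := mul_le_mul_of_nonneg_right (h1.trans h2) hw.le
    rw [he, mul_zero, mul_div_right_comm]
    linarith
  · obtain ⟨M, hM⟩ := hv.bdd T (by linarith)
    obtain ⟨r1, hr1, h⟩ := near0 (M := M) hC hγ
    refine ⟨r1, hr1, fun r hr t ht => ?_⟩
    have h1 := h r hr
    have h2 := hM r hr.1.le t ⟨by linarith [ht.1], ht.2⟩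
    have := hϕpos r hr.1
    linarith

/-- strictness at time one -/
lemma strict_one {n : ℕ} (hn : 10 < n) {p : ℝ} {v₀ : ℝ → ℝ} {v : ℝ → ℝ → ℝ} (hv : IsRadialSol n p v v₀) (hp : 1 < p)
    (hν : 0 < nuExp p) (hL : 0 < Lconst n p)
    (hL2 : Lconst n p ^ (p - 1) = nuExp p * ((n : ℝ) - 2 - nuExp p))
    (hS : ∀ r > (0:ℝ), ∀ t ≥ (0:ℝ), v r t ≤ Sst n p r) {r1 : ℝ} (hr1 : 0 < r1)
    (hb : ∀ t ∈ Icc (0:ℝ) 1, v r1 t + 1 ≤ Sst n p r1) {r2 : ℝ} (hr2 : r1 ≤ r2) :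
    v r2 1 < Sst n p r2 := by
  have hN : (10:ℝ) < n := by exact_mod_cast hn
  set c := r2 - r1 + 1 with hc
  have hc0 : 0 < c := by linarith
  set Q := Sst n p r1 ^ (p - 1) with hQ
  have hQ0 : 0 < Q := Real.rpow_pos_of_pos (S_pos hL hr1) _
  set μ := ((n:ℝ) - 1) / r1 + p * Q * c + 1 with hμ
  have hq1 : 0 < ((n:ℝ) - 1) / r1 := div_pos (by linarith) hr1
  have hq2 : 0 < p * Q * c := by have : 0 < p := by linarith
                                 positivity
  have hμ0 : 0 < μ := by linarith
  set ε := Real.exp (-(μ * c)) with hε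
  have hε0 : 0 < ε := Real.exp_pos _
  have key := first_touch (f := fun r t => v r t - (Sst n p r - ε * (Real.exp (μ * (r1 + c * t - r)) - 1)))
    (r1 := r1) (r2 := r1 + c + 1) (T0 := 0) (T1 := 1) ?_ ?_ ?_ ?_ ?_ r2 ⟨hr2, by linarith⟩ 1 ⟨by norm_num, le_rfl⟩
  · have : 1 < Real.exp (μ * (r1 + c * 1 - r2)) := by
      apply Real.one_lt_exp_iff.2
      apply mul_pos hμ0
      linarith
    have := mul_pos hε0 (sub_pos.2 this)
    linarith
  · have s2 : Icc r1 (r1 + c + 1) ×ˢ Icc (0:ℝ) 1 ⊆ Ici (0:ℝ) ×ˢ Ici (0:ℝ) := by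
      rintro ⟨x, y⟩ ⟨hx, hy⟩
      exact ⟨hr1.le.trans hx.1, hy.1⟩
    refine (hv.cont.mono s2).sub (ContinuousOn.sub ?_ (by fun_prop))
    exact continuousOn_const.mul (continuousOn_fst.rpow_const
      (fun x hx => Or.inl (ne_of_gt (lt_of_lt_of_le hr1 hx.1.1))))
  · intro r hr
    rcases hr.1.eq_or_lt with h | h
    · subst h
      have := hb 0 ⟨le_rfl, zero_le_one⟩
      simp only [mul_zero, add_zero, sub_self, Real.exp_zero]
      linarith
    · have h1 := hS r (by linarith) 0 le_rfl
      have : Real.exp (μ * (r1 + c * 0 - r)) < 1 := by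
        apply Real.exp_lt_one_iff.2
        apply mul_neg_of_pos_of_neg hμ0
        linarith
      have := mul_pos hε0 (sub_pos.2 this)
      show _ - _ < (0:ℝ)
      linarith
  · intro t ht
    have h1 := hb t ht
    have : ε * Real.exp (μ * (r1 + c * t - r1)) ≤ 1 := by
      rw [hε, ← Real.exp_add, Real.exp_le_one_iff]
      have : μ * (c * t) ≤ μ * (c * 1) := by
        have := ht.2; gcongr
      linarith
    show _ - _ < (0:ℝ)
    linarith
  · intro t ht
    have h1 := hS (r1 + c + 1) (by linarith) t ht.1
    have : Real.exp (μ * (r1 + c * t - (r1 + c + 1))) < 1 := by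
      apply Real.exp_lt_one_iff.2
      apply mul_neg_of_pos_of_neg hμ0
      have : c * t ≤ c * 1 := by have := ht.2; gcongr
      linarith
    have := mul_pos hε0 (sub_pos.2 this)
    show _ - _ < (0:ℝ)
    linarith
  · intro r hr t ht heq hsp htm
    have hr0 : 0 < r := hr1.trans hr.1
    obtain ⟨s1, s2, hDs, hs⟩ := S_D2 hp hL hL2 hr0
    set E := Real.exp (μ * (r1 + c * t - r)) with hE
    have hE0 : 0 < E := Real.exp_pos _
    have hexp : ∀ ρ : ℝ, HasDerivAt (fun ρ => Real.exp (μ * (r1 + c * t - ρ)))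
        (-μ * Real.exp (μ * (r1 + c * t - ρ))) ρ := by
      intro ρ
      have := (((hasDerivAt_id ρ).const_sub (r1 + c * t)).const_mul μ).exp
      refine this.congr_deriv ?_
      simp only [id]; ring
    have hDE : D2 (fun ρ => Real.exp (μ * (r1 + c * t - ρ))) r (-μ * E) (-μ * (-μ * E)) :=
      ⟨fun ρ => -μ * Real.exp (μ * (r1 + c * t - ρ)), Eventually.of_forall hexp, rfl,
        (hexp r).const_mul (-μ)⟩
    have hDΨ := hDs.sub ((hDE.sub (D2.const 1 r)).const_mul ε)
    have hT : HasDerivAt (fun s => Sst n p r - ε * (Real.exp (μ * (r1 + c * s - r)) - 1))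
        (-(ε * (μ * c * E))) t := by
      have := (((((((hasDerivAt_id t).const_mul c).const_add r1).sub_const r).const_mul μ).exp.sub_const 1).const_mul ε).const_sub
        (Sst n p r)
      refine this.congr_deriv ?_
      simp only [id, hE]; ring
    have htl := touch_upper hv hp hr0 ht.1
      (Ψ := fun r t => Sst n p r - ε * (Real.exp (μ * (r1 + c * t - r)) - 1))
      hDΨ hT (by linarith only [heq]) (hsp.mono fun x hx => by linarith only [hx])
      (htm.mono fun x hx => by linarith only [hx])
    have hval : Sst n p r - ε * (Real.exp (μ * (r1 + c * t - r)) - 1) = v r t := by linarith only [heq]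
    simp only [hval] at htl
    have hv0 := hv.nonneg r hr0.le t ht.1.le
    have hvS := hS r hr0 t ht.1.le
    have h1 : v r t ^ p ≤ Sst n p r ^ p := Real.rpow_le_rpow hv0 hvS (by linarith)
    have h2 : v r t ^ (p - 1) ≤ Q := by
      refine (Real.rpow_le_rpow hv0 hvS (by linarith)).trans ?_
      rw [hQ, S_pow hp hL hr0, S_pow hp hL hr1]
      have := hr.1.le
      gcongr
    have h3 : ((n:ℝ) - 1) / r ≤ ((n:ℝ) - 1) / r1 := by
      have := hr.1.le
      apply div_le_div_of_nonneg_left _ hr1 this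
      linarith
    have h4 : p * v r t ^ (p - 1) * c ≤ p * Q * c := by gcongr
    have h5 : 0 < ε * μ * E := by positivity
    have h6 : ((n:ℝ) - 1) / r + p * v r t ^ (p - 1) * c - μ < 0 := by linarith only [h3, h4, hμ]
    have h7 := mul_neg_of_pos_of_neg h5 h6
    linarith only [h7, htl, h1, hs]

lemma scal_D2 {n : ℕ} {p α a : ℝ} {φ : ℝ → ℝ} (hφ : IsSteadyStateA n p α φ a) (hp : 1 < p) {k : ℝ} (hk : 0 < k)
    {r : ℝ} (hr : 0 < r) : ∃ d1 d2, D2 (fun r => k ^ nuExp p * φ (k * r)) r d1 d2 ∧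
      d2 + ((n : ℝ) - 1) / r * d1 + (k ^ nuExp p * φ (k * r)) ^ p = 0 := by
  have hkr : 0 < k * r := mul_pos hk hr
  obtain ⟨d1, d2, hD, -, he⟩ := phi_D2 hφ hkr
  have hid : D2 (fun x : ℝ => k * x) r (k * 1) (k * 0) :=
    D2.const_mul k ⟨fun _ => 1, Eventually.of_forall fun x => hasDerivAt_id x, rfl, hasDerivAt_const r 1⟩
  refine ⟨_, _, (D2.comp (g := φ) (f := fun x => k * x) hD hid).const_mul (k ^ nuExp p), ?_⟩
  have e1 : (k ^ nuExp p * φ (k * r)) ^ p = k ^ nuExp p * k ^ 2 * φ (k * r) ^ p := by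
    rw [Real.mul_rpow (by positivity) (hφ.pos _ hkr.le).le, ← Real.rpow_mul hk.le]
    have : nuExp p * p = nuExp p + (2:ℝ) := by linarith [par_nu hp]
    rw [this, Real.rpow_add hk]
    norm_num
  rw [e1]
  have e2 : ((n : ℝ) - 1) / r * (k ^ nuExp p * (d1 * (k * 1))) = k ^ nuExp p * k ^ 2 * (((n : ℝ) - 1) / (k * r) * d1) := by
    field_simp
  rw [e2]
  linear_combination k ^ nuExp p * k ^ 2 * he

lemma scal_S {n : ℕ} {p k r : ℝ} (hk : 0 < k) (hr : 0 < r) :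
    k ^ nuExp p * Sst n p (k * r) = Sst n p r := by
  unfold Sst
  rw [Real.mul_rpow hk.le hr.le, Real.rpow_neg hk.le]
  have : k ^ nuExp p ≠ 0 := (Real.rpow_pos_of_pos hk _).ne'
  field_simp

lemma scal_c {n : ℕ} {p α a c : ℝ} {φ : ℝ → ℝ} (hφ : IsSteadyStateA n p α φ a) (hp : 1 < p) {k : ℝ} (hk : 1 ≤ k)
    (hc : ∀ r > (0:ℝ), c ≤ φ r ^ (p - 1) * (1 + r ^ 2)) {r : ℝ} (hr : 0 < r) :
    c ≤ (k ^ nuExp p * φ (k * r)) ^ (p - 1) * (1 + r ^ 2) := by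
  have hk0 : 0 < k := by linarith
  have hkr : 0 < k * r := mul_pos hk0 hr
  refine (hc _ hkr).trans ?_
  rw [Real.mul_rpow (by positivity) (hφ.pos _ hkr.le).le, ← Real.rpow_mul hk0.le, par_nu hp]
  have h := Real.rpow_pos_of_pos (hφ.pos _ hkr.le) (p - 1)
  have : k ^ (2:ℝ) = k ^ 2 := by norm_num
  rw [this, mul_comm (k ^ 2), mul_assoc]
  apply mul_le_mul_of_nonneg_left _ h.le
  nlinarith

lemma far_order {n : ℕ} {p α a γ : ℝ} {φ : ℝ → ℝ} (hφ : IsSteadyStateA n p α φ a)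
    (hlam : 0 < lam1 n p) (hγ : nuExp p + lam1 n p < γ) {C : ℝ} (hC : 0 < C) :
    ∃ R > (0:ℝ), ∀ k ≥ (2:ℝ), ∀ r ≥ R, φ r + C * r ^ (-γ) ≤ k ^ nuExp p * φ (k * r) := by
  have ha := hφ.a_pos
  set l1 := lam1 n p with hl
  set ν := nuExp p with hν
  set θ := (2:ℝ) ^ (-l1) with hθ
  have hθ0 : 0 < θ := by positivity
  have hθ1 : θ < 1 := Real.rpow_lt_one_of_one_lt_of_neg (by norm_num) (by linarith)
  set η := a * (1 - θ) / 4 with hη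
  have hη0 : 0 < η := by have : 0 < 1 - θ := by linarith
                         positivity
  obtain ⟨R1, hR1, h1⟩ := phi_exp hφ hη0
  obtain ⟨R2, hR2, h2⟩ := pow_small hγ (η := η / C) (by positivity)
  refine ⟨max R1 R2, by positivity, fun k hk r hr => ?_⟩
  have hr1 : R1 ≤ r := (le_max_left _ _).trans hr
  have hr0 : 0 < r := lt_of_lt_of_le hR1 hr1
  have hk0 : 0 < k := by linarith
  have e1 := (abs_le.1 (h1 r hr1)).2
  have e2 := (abs_le.1 (h1 (k * r) (by nlinarith))).1
  have e3 := h2 r ((le_max_right _ _).trans hr)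
  set X := r ^ (-ν - l1) with hX
  have hX0 : 0 < X := by positivity
  have e4 : C * r ^ (-γ) ≤ η * X := by
    have := mul_le_mul_of_nonneg_left e3 hC.le
    have e : C * (η / C * X) = η * X := by field_simp
    rw [neg_add', ← hX, e] at this; exact this
  have e5 : k ^ ν * (k * r) ^ (-ν - l1) = k ^ (-l1) * X := by
    rw [Real.mul_rpow hk0.le hr0.le, ← mul_assoc, ← Real.rpow_add hk0, ← hX]
    congr 2; ring
  have e6 : k ^ (-l1) ≤ θ := by
    rw [hθ]
    exact Real.rpow_le_rpow_of_nonpos (by norm_num) hk (by linarith)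
  have hkν : 0 < k ^ ν := by positivity
  have e7 := mul_le_mul_of_nonneg_left e2 hkν.le
  have e8 : k ^ ν * Sst n p (k * r) = Sst n p r := scal_S hk0 hr0
  have e9 : k ^ ν * (φ (k * r) - (Sst n p (k * r) - a * (k * r) ^ (-ν - l1)))
      = k ^ ν * φ (k * r) - Sst n p r + a * (k ^ (-l1) * X) := by
    rw [← e5, ← e8]; ring
  have e10 : k ^ ν * -(η * (k * r) ^ (-ν - l1)) = - (η * (k ^ (-l1) * X)) := by rw [← e5]; ring
  rw [e9, e10] at e7
  have e11 : k ^ (-l1) * X ≤ θ * X := by gcongr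
  have e12 : (a + η) * (k ^ (-l1) * X) ≤ (a + η) * (θ * X) := by gcongr
  have e13 : 0 ≤ ((a - η) - η - (a + η) * θ) * X := by
    apply mul_nonneg _ hX0.le
    have : η * θ ≤ η := by nlinarith
    rw [hη] at *; nlinarith
  linarith only [e7, e12, e13, e1, e4]

lemma v_bdd {n : ℕ} (hn : 10 < n) {p α a γ : ℝ} {φ v₀ : ℝ → ℝ} {v : ℝ → ℝ → ℝ}
    (hφ : IsSteadyStateA n p α φ a) (hv : IsRadialSol n p v v₀) (hp : 1 < p)
    (hν : 0 < nuExp p) (hL : 0 < Lconst n p)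
    (hL2 : Lconst n p ^ (p - 1) = nuExp p * ((n : ℝ) - 2 - nuExp p)) (hlam : 0 < lam1 n p)
    (hγ : nuExp p + lam1 n p < γ)
    (hAB : p * Lconst n p ^ (p - 1) < γ * ((n : ℝ) - 2 - γ))
    (hS : ∀ r > (0:ℝ), ∀ t ≥ (0:ℝ), v r t ≤ Sst n p r) {C : ℝ} (hC : 0 < C)
    (hu : ∀ r > (0:ℝ), v r 1 ≤ φ r + C * r ^ (-γ)) :
    ∃ β > (0:ℝ), ∀ r > (0:ℝ), ∀ t ≥ (1:ℝ), v r t ≤ β := by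
  have hγ0 : 0 < γ := by linarith
  have hα : 0 < α := by have := hφ.pos 0 le_rfl; rwa [hφ.val0] at this
  obtain ⟨M, hM⟩ := hv.bdd 1 one_pos
  obtain ⟨r1, hr1, hr1S⟩ := near0 (M := M + 1) hL hν
  have hr1S' : M + 1 < Sst n p r1 := hr1S r1 ⟨hr1, le_rfl⟩
  obtain ⟨R, hR, hfar⟩ := far_order hφ hlam hγ hC
  set r2 := max r1 R with hr2
  have hr12 : r1 ≤ r2 := le_max_left _ _
  have hstrict : ∀ r ≥ r1, v r 1 < Sst n p r := fun r hr =>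
    strict_one hn hv hp hν hL hL2 hS hr1 (fun t ht => by have := hM r1 hr1.le t ht; linarith) hr
  have hSc : ContinuousOn (Sst n p) (Icc r1 r2) :=
    continuousOn_const.mul (continuousOn_id.rpow_const
      (fun x hx => Or.inl (ne_of_gt (lt_of_lt_of_le hr1 hx.1))))
  have hvc : ContinuousOn (fun r => v r 1) (Icc r1 r2) := by
    have : ContinuousOn (fun r : ℝ => ((r, 1) : ℝ × ℝ)) (Icc r1 r2) := by fun_prop
    exact hv.cont.comp this (fun r hr => ⟨hr1.le.trans hr.1, (show (0:ℝ) ≤ 1 from zero_le_one)⟩)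
  obtain ⟨g, hg0, hg⟩ : ∃ g > (0:ℝ), ∀ r ∈ Icc r1 r2, v r 1 ≤ Sst n p r - g := by
    obtain ⟨x, hx, hmin⟩ := isCompact_Icc.exists_isMinOn (nonempty_Icc.2 hr12) (hSc.sub hvc)
    refine ⟨Sst n p x - v x 1, sub_pos.2 (hstrict x hx.1), fun r hr => ?_⟩
    have : Sst n p x - v x 1 ≤ Sst n p r - v r 1 := hmin hr
    linarith
  set g' := min g 1 with hg'
  have hg'0 : 0 < g' := by positivity
  have hS1 := S_pos hL hr1 (n := n) (p := p)
  set η := g' / Sst n p r1 with hη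
  have hη0 : 0 < η := by positivity
  obtain ⟨R3, hR3, hlow⟩ := phi_low hφ hL hlam hη0
  set k := max 2 (R3 / r1) with hk
  have hk2 : 2 ≤ k := le_max_left _ _
  have hk0 : 0 < k := by linarith
  have hkν : 0 < k ^ nuExp p := by positivity
  have hklow : ∀ r ≥ r1, Sst n p r - g' ≤ k ^ nuExp p * φ (k * r) := by
    intro r hr
    have hr0 : 0 < r := lt_of_lt_of_le hr1 hr
    have h1 : R3 ≤ k * r := by
      have : R3 / r1 ≤ k := le_max_right _ _
      rw [div_le_iff₀ hr1] at this
      exact this.trans (by gcongr)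
    have h2 := mul_le_mul_of_nonneg_left (hlow _ h1) hkν.le
    have e : k ^ nuExp p * ((1 - η) * Sst n p (k * r)) = (1 - η) * Sst n p r := by
      rw [← scal_S (n := n) (p := p) hk0 hr0]; ring
    rw [e] at h2
    have h3 : Sst n p r ≤ Sst n p r1 := by
      unfold Sst
      exact mul_le_mul_of_nonneg_left (Real.rpow_le_rpow_of_nonpos hr1 hr (by linarith)) hL.le
    have h4 := mul_le_mul_of_nonneg_left h3 hη0.le
    have h5 : η * Sst n p r1 = g' := by rw [hη]; field_simp
    linarith
  have hone : ∀ r > (0:ℝ), v r 1 ≤ k ^ nuExp p * φ (k * r) := by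
    intro r hr
    rcases le_total r r1 with h | h
    · have h1 := hklow r1 le_rfl
      have h2 : φ (k * r1) ≤ φ (k * r) :=
        hφ.anti.antitoneOn (mem_Ici.2 (by positivity)) (mem_Ici.2 (by positivity)) (by gcongr)
      have h3 := mul_le_mul_of_nonneg_left h2 hkν.le
      have h4 := hM r hr.le 1 ⟨zero_le_one, le_rfl⟩
      have : g' ≤ 1 := min_le_right _ _
      linarith
    · rcases le_total r r2 with h' | h'
      · have h1 := hklow r h
        have h2 := hg r ⟨h, h'⟩
        have : g' ≤ g := min_le_left _ _
        linarith
      · exact (hu r hr).trans (hfar k hk2 r ((le_max_right _ _).trans h'))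
  obtain ⟨c, hc, hφc⟩ := phi_c hφ hp hL hlam
  refine ⟨k ^ nuExp p * α, by positivity, fun r hr t ht => ?_⟩
  have hφα : φ (k * r) ≤ α := by
    rw [← hφ.val0]
    exact hφ.anti.antitoneOn (mem_Ici.2 le_rfl) (mem_Ici.2 (by positivity)) (by positivity)
  have hφα' := mul_le_mul_of_nonneg_left hφα hkν.le
  refine le_of_forall_pos_le_add fun ε hε => ?_
  have hrγ : 0 < r ^ (-γ) := by positivity
  have := comp_pow hv hp hL hγ0 hAB hS (ϕ := fun r => k ^ nuExp p * φ (k * r))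
    (fun r hr => scal_D2 hφ hp hk0 hr) (fun r hr => mul_pos hkν (hφ.pos _ (by positivity))) hc
    (fun r hr => scal_c hφ hp (by linarith) hφc hr) (t0 := 1) (C := ε / r ^ (-γ)) zero_le_one (by positivity)
    (fun r hr => by
      have := hone r hr
      have : 0 ≤ ε / r ^ (-γ) * r ^ (-γ) := by positivity
      refine (hone r hr).trans (le_add_of_nonneg_right ?_)
      positivity) r hr t ht
  have e : ε / r ^ (-γ) * r ^ (-γ) = ε := by field_simp
  rw [e] at this
  linarith

lemma algE {A B Q D : ℝ} (hB : 0 < B) (hAB : B < A) (hQ : 0 < Q) (hD : A ≤ D) :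
    ∃ η > (0:ℝ), ∃ s > (0:ℝ), s ≤ 1 ∧ ∀ r > (0:ℝ), ∀ q ≥ (0:ℝ), q ≤ B / r ^ 2 → q ≤ Q →
      (1 + η) * q * (r ^ 2 + s ^ 2) ^ 2 ≤ A * r ^ 2 + D * s ^ 2 := by
  set τ := min 1 ((A - B) / (7 * B)) with hτ
  have hA : 0 < A := hB.trans hAB
  have hτ0 : 0 < τ := lt_min one_pos (div_pos (by linarith) (by linarith))
  have hτ1 : τ ≤ 1 := min_le_left _ _
  have hτB : 7 * B * τ ≤ A - B := by
    have : τ ≤ (A - B) / (7 * B) := min_le_right _ _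
    rw [le_div_iff₀ (by linarith)] at this; linarith
  have h3 : B * (1 + τ) ^ 3 ≤ A := by
    have h1 : (1 + τ) ^ 3 ≤ 1 + 7 * τ := by
      have h2 : τ ^ 2 ≤ τ := by nlinarith
      have h3 : τ ^ 3 ≤ τ := by nlinarith
      nlinarith
    have := mul_le_mul_of_nonneg_left h1 hB.le
    linarith
  set Z := (1 + τ) * Q * (1 + 1 / τ) with hZ
  have hZ0 : 0 < Z := by positivity
  set s := min 1 (A / Z) with hs
  have hs0 : 0 < s := by positivity
  have hs1 : s ≤ 1 := min_le_left _ _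
  have hsZ : Z * s ^ 2 ≤ A := by
    have h1 : s ≤ A / Z := min_le_right _ _
    rw [le_div_iff₀ hZ0] at h1
    have : s ^ 2 ≤ s := by nlinarith
    have := mul_le_mul_of_nonneg_left this hZ0.le
    linarith
  refine ⟨τ, hτ0, s, hs0, hs1, fun r hr q hq hq1 hq2 => ?_⟩
  have hr2 : 0 < r ^ 2 := by positivity
  have hs2 : 0 < s ^ 2 := by positivity
  have hD0 : 0 < D := by linarith
  rcases le_total (s ^ 2) (τ * r ^ 2) with h | h
  · have h1 : r ^ 2 + s ^ 2 ≤ (1 + τ) * r ^ 2 := by linarith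
    calc (1 + τ) * q * (r ^ 2 + s ^ 2) ^ 2 ≤ (1 + τ) * (B / r ^ 2) * ((1 + τ) * r ^ 2) ^ 2 := by gcongr
      _ = B * (1 + τ) ^ 3 * r ^ 2 := by field_simp
      _ ≤ A * r ^ 2 := by gcongr
      _ ≤ _ := by have := mul_pos hD0 hs2; linarith
  · have h1 : r ^ 2 + s ^ 2 ≤ (1 + 1 / τ) * s ^ 2 := by
      have : r ^ 2 ≤ s ^ 2 / τ := by rw [le_div_iff₀ hτ0]; linarith
      have e : (1 + 1 / τ) * s ^ 2 = s ^ 2 + s ^ 2 / τ := by ring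
      rw [e]; linarith
    calc (1 + τ) * q * (r ^ 2 + s ^ 2) ^ 2 ≤ (1 + τ) * Q * ((r ^ 2 + s ^ 2) * ((1 + 1 / τ) * s ^ 2)) := by
          rw [sq (r ^ 2 + s ^ 2)]; gcongr
      _ = Z * s ^ 2 * (r ^ 2 + s ^ 2) := by rw [hZ]; ring
      _ ≤ A * (r ^ 2 + s ^ 2) := by gcongr
      _ ≤ _ := by
        have := mul_le_mul_of_nonneg_right hD hs2.le; linarith

lemma bump_D2 {n : ℕ} {s γ r : ℝ} (hr : 0 < r) : ∃ d1 d2,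
    D2 (fun ρ => (ρ ^ 2 + s ^ 2) ^ (-γ / 2)) r d1 d2 ∧
    d2 + ((n : ℝ) - 1) / r * d1 = - ((r ^ 2 + s ^ 2) ^ (-γ / 2) *
      (γ * ((n : ℝ) - 2 - γ) * r ^ 2 + γ * n * s ^ 2) / (r ^ 2 + s ^ 2) ^ 2) := by
  have hu : 0 < r ^ 2 + s ^ 2 := by positivity
  have hD : D2 (fun ρ : ℝ => ρ ^ 2 + s ^ 2) r (2 * r) 2 :=
    ⟨fun x => 2 * x, Eventually.of_forall fun x => by
      simpa using (hasDerivAt_pow 2 x).add_const (s ^ 2), rfl,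
      by simpa using (hasDerivAt_id r).const_mul 2⟩
  refine ⟨_, _, D2.comp (g := fun x => x ^ (-γ / 2)) (f := fun ρ => ρ ^ 2 + s ^ 2) (D2.rpow hu (-γ / 2)) hD, ?_⟩
  field_simp
  ring

lemma decay {n : ℕ} {p γ β c C1 : ℝ} {v₀ : ℝ → ℝ} {v : ℝ → ℝ → ℝ} (hv : IsRadialSol n p v v₀) (hp : 1 < p)
    (hL : 0 < Lconst n p) (hγ : 0 < γ)
    (hAB : p * Lconst n p ^ (p - 1) < γ * ((n : ℝ) - 2 - γ))
    (hS : ∀ r > (0:ℝ), ∀ t ≥ (0:ℝ), v r t ≤ Sst n p r) {ϕ : ℝ → ℝ}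
    (hϕD : ∀ r > (0:ℝ), ∃ d1 d2, D2 ϕ r d1 d2 ∧ d2 + ((n : ℝ) - 1) / r * d1 + ϕ r ^ p = 0)
    (hϕpos : ∀ r > (0:ℝ), 0 < ϕ r) (hc : 0 < c)
    (hϕc : ∀ r > (0:ℝ), c ≤ ϕ r ^ (p - 1) * (1 + r ^ 2)) (hβ : 0 < β)
    (hvβ : ∀ r > (0:ℝ), ∀ t ≥ (1:ℝ), v r t ≤ β) (hC1 : 0 < C1) {η s : ℝ} (hs0 : 0 < s)
    (hE : ∀ r > (0:ℝ), ∀ q ≥ (0:ℝ), q ≤ p * Lconst n p ^ (p - 1) / r ^ 2 → q ≤ p * β ^ (p - 1) →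
      (1 + η) * q * (r ^ 2 + s ^ 2) ^ 2 ≤ γ * ((n : ℝ) - 2 - γ) * r ^ 2 + γ * n * s ^ 2)
    (hin : ∀ r > (0:ℝ), v r 1 ≤ ϕ r + C1 * (r ^ 2 + s ^ 2) ^ (-γ / 2)) :
    ∀ r > (0:ℝ), ∀ t ≥ (1:ℝ), v r t ≤ ϕ r + C1 * Real.exp (-η * (t - 1)) * (r ^ 2 + s ^ 2) ^ (-γ / 2) := by
  have key : ∀ δ > (0:ℝ), ∀ r > (0:ℝ), ∀ t ≥ (1:ℝ), v r t ≤ ϕ r +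
      (C1 * Real.exp (-η * (t - 1)) * (r ^ 2 + s ^ 2) ^ (-γ / 2) + δ * r ^ (-γ)) := by
    intro δ hδ
    refine upper_comp hv hp hϕD hϕpos hc hϕc
      (W := fun r t => C1 * Real.exp (-η * (t - 1)) * (r ^ 2 + s ^ 2) ^ (-γ / 2) + δ * r ^ (-γ)) zero_le_one
      (fun r hr t ht => by positivity) ?_ (fun r hr t ht => ?_) (fun T hT => ?_) (fun r hr => ?_)
    · refine ContinuousOn.add (ContinuousOn.mul (by fun_prop) ?_) pow_cont
      refine ContinuousOn.rpow_const (by fun_prop) (fun x hx => Or.inl ?_)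
      have : 0 < x.1 := hx.1
      positivity
    · obtain ⟨d1, d2, hD, he⟩ := pow_D2 (n := n) (C := δ) (γ := γ) hr
      obtain ⟨b1, b2, hb, hbe⟩ := bump_D2 (n := n) (s := s) (γ := γ) hr
      have hT : HasDerivAt (fun t => C1 * Real.exp (-η * (t - 1)) * (r ^ 2 + s ^ 2) ^ (-γ / 2) + δ * r ^ (-γ))
          (-η * (C1 * Real.exp (-η * (t - 1)) * (r ^ 2 + s ^ 2) ^ (-γ / 2))) t := by
        have := ((((((hasDerivAt_id t).sub_const 1).const_mul (-η)).exp.const_mul C1).mul_const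
          ((r ^ 2 + s ^ 2) ^ (-γ / 2))).add_const (δ * r ^ (-γ)))
        refine this.congr_deriv ?_
        simp only [id]; ring
      refine ⟨_, _, _, (hb.const_mul (C1 * Real.exp (-η * (t - 1)))).add hD, hT, fun _ => ?_⟩
      have ht' : 0 ≤ t := by linarith
      have hv0 := hv.nonneg r hr.le t ht'
      have h1 := vpow_le hp hL hr hv0 (hS r hr t ht')
      have hw : 0 < δ * r ^ (-γ) := by positivity
      have h2 : p * Lconst n p ^ (p - 1) / r ^ 2 ≤ γ * ((n : ℝ) - 2 - γ) / r ^ 2 := by gcongr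
      have h3 := mul_le_mul_of_nonneg_right (h1.trans h2) hw.le
      have hp0 : 0 < p := by linarith
      have h4 : p * v r t ^ (p - 1) ≤ p * β ^ (p - 1) :=
        mul_le_mul_of_nonneg_left (Real.rpow_le_rpow hv0 (hvβ r hr t ht.le) (by linarith)) hp0.le
      have hq0 : 0 ≤ p * v r t ^ (p - 1) := by positivity
      have h5 := hE r hr _ hq0 h1 h4
      set q := p * v r t ^ (p - 1)
      set e := Real.exp (-η * (t - 1))
      have he0 : 0 < e := Real.exp_pos _
      set g := (r ^ 2 + s ^ 2) ^ (-γ / 2)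
      have hg0 : 0 < g := by positivity
      have h6 : (1 + η) * q ≤ (γ * ((n : ℝ) - 2 - γ) * r ^ 2 + γ * n * s ^ 2) / (r ^ 2 + s ^ 2) ^ 2 := by
        rw [le_div_iff₀ (by positivity)]; exact h5
      have h7 := mul_le_mul_of_nonneg_left h6 (by positivity : 0 ≤ C1 * e * g)
      have e1 : C1 * e * b2 + ((n:ℝ) - 1) / r * (C1 * e * b1) = - (C1 * e * g * ((γ * ((n : ℝ) - 2 - γ) * r ^ 2 + γ * n * s ^ 2) / (r ^ 2 + s ^ 2) ^ 2)) := by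
        linear_combination C1 * e * hbe
      have e2 : d2 + ((n:ℝ) - 1) / r * d1 = - (γ * ((n : ℝ) - 2 - γ) / r ^ 2 * (δ * r ^ (-γ))) := by
        rw [he]; ring
      show C1 * e * b2 + d2 + ((n:ℝ) - 1) / r * (C1 * e * b1 + d1) + q * (C1 * e * g + δ * r ^ (-γ)) ≤ _
      rw [mul_add (((n:ℝ) - 1) / r)]
      linarith only [e1, e2, h7, h3]
    · obtain ⟨M, hM⟩ := hv.bdd T (by linarith)
      obtain ⟨r1, hr1, h⟩ := near0 (M := M) hδ hγ
      refine ⟨r1, hr1, fun r hr t ht => ?_⟩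
      have h1 := h r hr
      have h2 := hM r hr.1.le t ⟨by linarith [ht.1], ht.2⟩
      have := hϕpos r hr.1
      have hr0 := hr.1
      have : 0 < C1 * Real.exp (-η * (t - 1)) * (r ^ 2 + s ^ 2) ^ (-γ / 2) := by positivity
      linarith
    · have := hin r hr
      have : 0 < δ * r ^ (-γ) := by positivity
      simp only [sub_self, mul_zero, Real.exp_zero, mul_one]
      linarith
  intro r hr t ht
  refine le_of_forall_pos_le_add fun ε hε => ?_
  have hrγ : 0 < r ^ (-γ) := by positivity
  have := key (ε / r ^ (-γ)) (by positivity) r hr t ht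
  have e : ε / r ^ (-γ) * r ^ (-γ) = ε := by field_simp
  rw [e] at this
  linarith

lemma ext0 {f : ℝ → ℝ} {K : ℝ} (hf : ContinuousOn f (Ici 0)) (h : ∀ r > (0:ℝ), f r ≤ K) :
    ∀ r ≥ (0:ℝ), f r ≤ K := by
  intro r hr
  rcases hr.eq_or_lt with h0 | h0
  · subst h0
    have h1 : Tendsto f (nhdsWithin 0 (Ioi 0)) (nhds (f 0)) :=
      (hf 0 (mem_Ici.2 le_rfl)).mono_left (nhdsWithin_mono _ Ioi_subset_Ici_self)
    exact le_of_tendsto h1 (eventually_nhdsWithin_of_forall h)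
  · exact h r h0

lemma pw1 {γ r : ℝ} (hγ : 0 < γ) (hr : 0 < r) (h : r ≤ 1) : 1 ≤ 2 ^ γ * (r + 1) ^ (-γ) := by
  rw [Real.rpow_neg (by linarith), ← div_eq_mul_inv, one_le_div (by positivity)]
  exact Real.rpow_le_rpow (by linarith) (by linarith) hγ.le

lemma pw2 {γ r : ℝ} (hγ : 0 < γ) (h : 1 ≤ r) : r ^ (-γ) ≤ 2 ^ γ * (r + 1) ^ (-γ) := by
  have hr : 0 < r := by linarith
  rw [Real.rpow_neg (by linarith), Real.rpow_neg (by linarith), ← div_eq_mul_inv,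
    ← Real.div_rpow (by norm_num) (by linarith), ← Real.inv_rpow hr.le]
  apply Real.rpow_le_rpow (by positivity) _ hγ.le
  rw [inv_eq_one_div, div_le_div_iff₀ hr (by linarith)]
  linarith

lemma sq_pw {γ x : ℝ} (hx : 0 < x) : (x ^ 2) ^ (-γ / 2) = x ^ (-γ) := by
  rw [← Real.rpow_natCast, ← Real.rpow_mul hx.le]
  congr 1; push_cast; ring

lemma pw3 {γ r s : ℝ} (hγ : 0 < γ) (hr : 0 < r) (hs : 0 < s) (hs1 : s ≤ 1) :
    (r + 1) ^ (-γ) ≤ (r ^ 2 + s ^ 2) ^ (-γ / 2) := by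
  rw [← sq_pw (by linarith : 0 < r + 1)]
  exact Real.rpow_le_rpow_of_nonpos (by positivity) (by nlinarith) (by linarith)

lemma pw4 {γ r s : ℝ} (hγ : 0 < γ) (hr : 0 < r) (hs : 0 < s) (hs1 : s ≤ 1) :
    (r ^ 2 + s ^ 2) ^ (-γ / 2) ≤ (s / 2) ^ (-γ) * (r + 1) ^ (-γ) := by
  rw [← Real.mul_rpow (by positivity) (by positivity), ← sq_pw (by positivity : 0 < s / 2 * (r + 1))]
  refine Real.rpow_le_rpow_of_nonpos (by positivity) ?_ (by linarith)
  have : s ^ 2 ≤ 1 := by nlinarith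
  have h2 : (r + 1) ^ 2 ≤ 2 * (1 + r ^ 2) := by nlinarith [sq_nonneg (r - 1)]
  have h3 := mul_le_mul_of_nonneg_left h2 (sq_nonneg s)
  have h4 : s ^ 2 * r ^ 2 ≤ 1 * r ^ 2 := by gcongr
  nlinarith

lemma pw5 {γ r s : ℝ} (hγ : 0 < γ) (hs : 0 < s) : (r ^ 2 + s ^ 2) ^ (-γ / 2) ≤ s ^ (-γ) := by
  rw [← sq_pw hs]
  exact Real.rpow_le_rpow_of_nonpos (by positivity) (by nlinarith [sq_nonneg r]) (by linarith)


/-- Lemma 3.2: let `n > 10`, `p > p_c`, `α > 0`, and let `v₀` be continuous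
with `0 ≤ v₀ ≤ L r^{−ν}` for `r > 0`, `φ_α ≤ v₀`, and `v₀(r) ≤ φ_α(r) + b r^{−γ}` for
`r > 1`, with `b > 0` and `γ ∈ (ν+λ₁, (n−2)/2)`. Then every bounded classical radial
solution `v` with initial data `v₀` satisfies `sup_{r≥0} |v(r,t) − φ_α(r)| → 0` as
`t → ∞`, and `v(r,t) ≤ φ_α(r) + C(r+1)^{−γ}` for some `C > 0`. -/
theorem radial_convergence_from_above (n : ℕ) (hn : 10 < n) (p α b γ : ℝ)
    (hp : pc n < p) (hα : 0 < α) (hb : 0 < b)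
    (hγ : γ ∈ Set.Ioo (nuExp p + lam1 n p) (((n : ℝ) - 2) / 2))
    (φ : ℝ → ℝ) (a : ℝ) (hφ : IsSteadyStateA n p α φ a)
    (v₀ : ℝ → ℝ) (hv₀cont : ContinuousOn v₀ (Set.Ici 0))
    (hv₀nonneg : ∀ r > (0 : ℝ), 0 ≤ v₀ r)
    (hv₀upper : ∀ r > (0 : ℝ), v₀ r ≤ Lconst n p * r ^ (-nuExp p))
    (hv₀ge : ∀ r ≥ (0 : ℝ), φ r ≤ v₀ r)
    (hv₀close : ∀ r > (1 : ℝ), v₀ r ≤ φ r + b * r ^ (-γ))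
    (v : ℝ → ℝ → ℝ) (hv : IsRadialSol n p v v₀) :
    Tendsto (fun t => ⨆ r : Set.Ici (0 : ℝ), |v r t - φ r|) atTop (nhds 0) ∧
    ∃ C > 0, ∀ r ≥ (0 : ℝ), ∀ t ≥ (0 : ℝ), v r t ≤ φ r + C * (r + 1) ^ (-γ) := by
  obtain ⟨hp1, hν, h2ν⟩ := par_p hn hp
  obtain ⟨hL, hL2⟩ := par_L hp1 hν h2ν
  obtain ⟨hlam, hlt⟩ := par_lam hν h2ν hγ
  have hN : (10:ℝ) < n := by exact_mod_cast hn
  have hγ1 := hγ.1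
  have hγ2 := hγ.2
  have hγ0 : 0 < γ := by linarith
  have hAB : p * Lconst n p ^ (p - 1) < γ * ((n : ℝ) - 2 - γ) := by
    rw [hL2]
    have e : p * (nuExp p * ((n : ℝ) - 2 - nuExp p)) = (nuExp p + 2) * ((n : ℝ) - 2 - nuExp p) := by
      linear_combination ((n : ℝ) - 2 - nuExp p) * par_nu hp1
    rw [e]; exact hlt
  have hlow := lower_comp hn hφ hv hp1 hν h2ν hL hL2 hlam (by linarith) hAB
    (fun r hr => by rw [hv.init r hr.le]; exact hv₀ge r hr.le)
  have hS := v_le_S hv hp1 hν hL hL2 (fun r hr => by rw [hv.init r hr.le]; exact hv₀upper r hr)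
  obtain ⟨c, hc, hφc⟩ := phi_c hφ hp1 hL hlam
  have hφD : ∀ r > (0:ℝ), ∃ d1 d2, D2 φ r d1 d2 ∧ d2 + ((n : ℝ) - 1) / r * d1 + φ r ^ p = 0 := by
    intro r hr
    obtain ⟨d1, d2, h1, -, h2⟩ := phi_D2 hφ hr
    exact ⟨d1, d2, h1, h2⟩
  have hφpos : ∀ r > (0:ℝ), 0 < φ r := fun r hr => hφ.pos r hr.le
  obtain ⟨M, hM⟩ := hv.bdd 1 one_pos
  set C := b + |M| with hCdef
  have hC : 0 < C := by positivity
  have hCb : b ≤ C := by have := abs_nonneg M; linarith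
  have hCM : M ≤ C := by have := le_abs_self M; linarith
  have hu := comp_pow hv hp1 hL hγ0 hAB hS hφD hφpos hc hφc (t0 := 0) le_rfl hC (fun r hr => by
    have hrp : 0 < r ^ (-γ) := by positivity
    rcases lt_or_ge 1 r with h | h
    · rw [hv.init r hr.le]
      refine (hv₀close r h).trans ?_
      gcongr
    · have h1 := hM r hr.le 0 ⟨le_rfl, zero_le_one⟩
      have h2 : 1 ≤ r ^ (-γ) := Real.one_le_rpow_of_pos_of_le_one_of_nonpos hr h (by linarith)
      have h3 := mul_le_mul_of_nonneg_left h2 hC.le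
      have := hφpos r hr
      linarith)
  obtain ⟨β, hβ, hvβ⟩ := v_bdd hn hφ hv hp1 hν hL hL2 hlam hγ1 hAB hS hC (fun r hr => hu r hr 1 zero_le_one)
  have hp0 : 0 < p := by linarith
  obtain ⟨η, hη, s, hs0, hs1, hE⟩ := algE (A := γ * ((n : ℝ) - 2 - γ)) (B := p * Lconst n p ^ (p - 1))
    (Q := p * β ^ (p - 1)) (D := γ * n) (by positivity) hAB (by positivity) (by nlinarith)
  set C1 := C * 2 ^ γ with hC1
  have hC10 : 0 < C1 := by positivity
  have hu1 : ∀ r > (0:ℝ), ∀ t ∈ Icc (0:ℝ) 1, v r t ≤ φ r + C1 * (r + 1) ^ (-γ) := by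
    intro r hr t ht
    rcases le_total r 1 with h | h
    · have h1 := hM r hr.le t ht
      have h2 := mul_le_mul_of_nonneg_left (pw1 hγ0 hr h) hC.le
      have := hφpos r hr
      rw [hC1, mul_assoc]; linarith
    · have h1 := hu r hr t ht.1
      have h2 := mul_le_mul_of_nonneg_left (pw2 hγ0 h) hC.le
      rw [hC1, mul_assoc]; linarith
  have hdec := decay hv hp1 hL hγ0 hAB hS hφD hφpos hc hφc hβ hvβ hC10 hs0 hE (fun r hr => by
    have h1 := hu1 r hr 1 ⟨zero_le_one, le_rfl⟩
    have h2 := mul_le_mul_of_nonneg_left (pw3 hγ0 hr hs0 hs1) hC10.le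
    linarith)
  have hvc : ∀ t ≥ (0:ℝ), ContinuousOn (fun r => v r t) (Ici 0) := by
    intro t ht
    have : ContinuousOn (fun r : ℝ => ((r, t) : ℝ × ℝ)) (Ici 0) := by fun_prop
    exact hv.cont.comp this (fun r hr => ⟨hr, ht⟩)
  constructor
  · have hb1 : ∀ t ≥ (1:ℝ), ∀ r ≥ (0:ℝ), |v r t - φ r| ≤ C1 * Real.exp (-η * (t - 1)) * s ^ (-γ) := by
      intro t ht r hr
      have ht0 : 0 ≤ t := by linarith
      have h1 := ext0 (hφ.cont.sub (hvc t ht0)) (K := 0)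
        (fun r hr => sub_nonpos.2 (hlow r hr t ht0)) r hr
      have h2 := ext0 ((hvc t ht0).sub hφ.cont) (K := C1 * Real.exp (-η * (t - 1)) * s ^ (-γ))
        (fun r hr => by
          have h3 := hdec r hr t ht
          have h4 := mul_le_mul_of_nonneg_left (pw5 (r := r) hγ0 hs0)
            (by positivity : 0 ≤ C1 * Real.exp (-η * (t - 1)))
          simp only [Pi.sub_apply]
          linarith) r hr
      simp only [Pi.sub_apply] at h1 h2
      rw [abs_of_nonneg (by linarith)]
      exact h2
    have hlim : Tendsto (fun t : ℝ => C1 * Real.exp (-η * (t - 1)) * s ^ (-γ)) atTop (nhds 0) := by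
      have h1 : Tendsto (fun t : ℝ => Real.exp (-η * (t - 1))) atTop (nhds 0) := by
        apply Real.tendsto_exp_atBot.comp
        exact (tendsto_atTop_add_const_right atTop (-1) tendsto_id).const_mul_atTop_of_neg (by linarith)
      simpa using (h1.const_mul C1).mul_const (s ^ (-γ))
    refine squeeze_zero' (Eventually.of_forall fun t => Real.iSup_nonneg fun _ => abs_nonneg _) ?_ hlim
    filter_upwards [eventually_ge_atTop 1] with t ht
    haveI : Nonempty (Ici (0:ℝ)) := ⟨⟨0, mem_Ici.2 le_rfl⟩⟩
    exact ciSup_le fun r => hb1 t ht r r.2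
  · set C2 := C1 + C1 * (s / 2) ^ (-γ) with hC2
    have hC20 : 0 < C1 * (s / 2) ^ (-γ) := by positivity
    refine ⟨C2, by positivity, fun r hr t ht => ?_⟩
    have hcont : ContinuousOn (fun r : ℝ => C2 * (r + 1) ^ (-γ)) (Ici 0) := by
      refine continuousOn_const.mul (ContinuousOn.rpow_const (by fun_prop) fun x hx => Or.inl ?_)
      have : (0:ℝ) ≤ x := hx
      positivity
    have h2 := ext0 (((hvc t ht).sub hφ.cont).sub hcont) (K := 0) (fun r hr => by
      simp only [Pi.sub_apply]
      have hrp : 0 < (r + 1) ^ (-γ) := by positivity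
      rcases le_total t 1 with h | h
      · have h3 := hu1 r hr t ⟨ht, h⟩
        have := mul_pos hC20 hrp
        rw [hC2, add_mul]; linarith
      · have h3 := hdec r hr t h
        have he : Real.exp (-η * (t - 1)) ≤ 1 := by
          rw [Real.exp_le_one_iff]
          have := mul_nonneg hη.le (sub_nonneg.2 h); linarith
        have h4 : C1 * Real.exp (-η * (t - 1)) * (r ^ 2 + s ^ 2) ^ (-γ / 2)
            ≤ C1 * 1 * ((s / 2) ^ (-γ) * (r + 1) ^ (-γ)) := by
          have := pw4 hγ0 hr hs0 hs1
          gcongr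
        have := mul_pos hC10 hrp
        rw [hC2, add_mul]; linarith) r hr
    simp only [Pi.sub_apply] at h2
    linarith
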